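/- arXiv:2408.08436 — 4 statements merged into one kernel-verified Lean document; each statement's English description precedes it below -/
import Mathlib

section
/- There exists an infinite set S of squarefree integers with the following properties. For every d ∈ S: (i) for every field K equipped with a ℚ-algebra structure of dimension at most 2 over ℚ, there is no nonzero x ∈ K^5 with Q_0^{(d)}(x) = Q_∞^{(d)}(x) = 0; and (ii) the greatest common divisor of the set of degrees [K:ℚ], taken over all finite field extensions K of ℚ for which there exists a nonzero x ∈ K^5 with Q_0^{(d)}(x) = Q_∞^{(d)}(x) = 0, equals 2. Moreover, for distinct d, d' ∈ S there is no ℚ-linear automorphism g of ℚ^5 carrying the span of {Q_0^{(d)}∘g, Q_∞^{(d)}∘g} onto the span of {Q_0^{(d')}, Q_∞^{(d')}}, so the surfaces X_d for d ∈ S are pairwise non-isomorphic. (That is, there are infinitely many smooth intersections of two quadrics over ℚ that have index 2 but no closed points of degree 2.) -/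
/-- The quadratic form `Q₀⁽ᵈ⁾ = d(u₀² - 3u₁²) + 6u₂² + 6u₂u₃ - 6u₃u₄`. -/
def Q0 (d : ℤ) {F : Type*} [Field F] (u : Fin 5 → F) : F :=
  (d : F) * (u 0 ^ 2 - 3 * u 1 ^ 2) + 6 * u 2 ^ 2 + 6 * u 2 * u 3 - 6 * u 3 * u 4

/-- The quadratic form `Q∞⁽ᵈ⁾ = -2d·u₀u₁ + u₂² - 2u₂u₄ - 3u₃² - u₄²`. -/
def Qinf (d : ℤ) {F : Type*} [Field F] (u : Fin 5 → F) : F :=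
  -2 * (d : F) * u 0 * u 1 + u 2 ^ 2 - 2 * u 2 * u 4 - 3 * u 3 ^ 2 - u 4 ^ 2

/-- The set of degrees of closed points on `X_d`: the degrees `[K:ℚ]` of finite field
extensions `K/ℚ` over which `Q₀⁽ᵈ⁾` and `Q∞⁽ᵈ⁾` have a common nonzero zero in `K⁵`. -/
def Degrees (d : ℤ) : Set ℕ :=
  {n | ∃ (K : Type) (_ : Field K) (_ : Algebra ℚ K) (_ : FiniteDimensional ℚ K),
    Module.finrank ℚ K = n ∧ ∃ x : Fin 5 → K, x ≠ 0 ∧ Q0 d x = 0 ∧ Qinf d x = 0}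

section

open NumberField WithZero

/-- A number field of odd degree has a place above `3` with odd ramification index and odd
residue degree. -/
theorem exists_valuation_three_odd (K : Type) [Field K] [NumberField K]
    (hodd : Odd (Module.finrank ℚ K)) :
    ∃ v : Valuation K ℤᵐ⁰, (∃ e : ℕ, Odd e ∧ v 3 = exp (-(e : ℤ))) ∧
      (∀ n : ℤ, ¬ 3 ∣ n → v n = 1) ∧
      ∀ x y : K, v x ≤ v y → v (x ^ 2 + y ^ 2) = v y ^ 2 := by
  have h3 : Prime (3 : ℤ) := Int.prime_three
  let p : Ideal ℤ := Ideal.span {3}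
  have hp0 : p ≠ ⊥ := by simp [p]
  have hpp : p.IsPrime := (Ideal.span_singleton_prime (by norm_num)).2 h3
  have hpm : p.IsMaximal := hpp.isMaximal hp0
  have hsum := Ideal.sum_ramification_inertia (R := ℤ) (S := 𝓞 K) ℚ K hp0
  obtain ⟨P, hP, hPodd⟩ : ∃ P ∈ _root_.IsDedekindDomain.primesOverFinset p (𝓞 K),
      Odd (p.ramificationIdx' P * p.inertiaDeg' P) := by
    by_contra! hcon
    rw [← hsum] at hodd
    exact Nat.not_odd_iff_even.2
      (Finset.even_sum _ fun P hP => Nat.not_odd_iff_even.1 (hcon P hP)) hodd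
  obtain ⟨he, hf⟩ := Nat.odd_mul.1 hPodd
  rw [_root_.IsDedekindDomain.mem_primesOverFinset_iff hp0] at hP
  obtain ⟨hPprime, hPover⟩ := hP
  have hPbot : P ≠ ⊥ := Ideal.ne_bot_of_liesOver_of_ne_bot hp0 P
  let w : IsDedekindDomain.HeightOneSpectrum (𝓞 K) := ⟨P, hPprime, hPbot⟩
  have hmem3 : (3 : 𝓞 K) ∈ P := by
    have := (Ideal.mem_of_liesOver P p (3 : ℤ)).1 (Ideal.mem_span_singleton_self 3)
    simpa using this
  have hint : ∀ n : ℤ, ¬ 3 ∣ n → w.valuation K n = 1 := by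
    intro n hn
    have : ((n : 𝓞 K)) ∉ P := fun h => hn (by
      have := (Ideal.mem_of_liesOver P p n).2 (by simpa using h)
      exact Ideal.mem_span_singleton.1 this)
    have h := (w.valuation_eq_one_iff_notMem (K := K) (r := (n : 𝓞 K))).2 this
    simpa using h
  have hcard : Nat.card (𝓞 K ⧸ P) % 4 = 3 := by
    have := Ideal.absNorm_eq_pow_inertiaDeg' (R := 𝓞 K) (p := 3) P Nat.prime_three
    rw [Ideal.absNorm_apply, Submodule.cardQuot_apply] at this
    rw [this]
    obtain ⟨k, hk⟩ := hf
    have hk' : (Ideal.span {((3 : ℕ) : ℤ)}).inertiaDeg' P = 2 * k + 1 := hk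
    rw [hk', pow_succ, pow_mul, Nat.mul_mod, Nat.pow_mod]
    norm_num
  have hsq : ∀ a : 𝓞 K, 1 + a ^ 2 ∉ P := by
    intro a ha
    have : P.IsMaximal := hPprime.isMaximal hPbot
    let := Ideal.Quotient.field P
    have : Finite (𝓞 K ⧸ P) := Ideal.finiteQuotientOfFreeOfNeBot P hPbot
    let := Fintype.ofFinite (𝓞 K ⧸ P)
    refine FiniteField.isSquare_neg_one_iff (F := 𝓞 K ⧸ P) |>.1 ⟨Ideal.Quotient.mk P a, ?_⟩ ?_
    · have := Ideal.Quotient.eq_zero_iff_mem.2 ha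
      rw [map_add, map_pow, map_one] at this
      linear_combination -this
    · rw [← Nat.card_eq_fintype_card, hcard]
  refine ⟨w.valuation K, ⟨_, he, ?_⟩, hint, ?_⟩
  · have h3' : (3 : 𝓞 K) ≠ 0 := by norm_num
    have := w.valuation_of_algebraMap (K := K) (3 : 𝓞 K)
    rw [w.intValuation_eq_exp_neg_multiplicity h3'] at this
    have hmap : Ideal.map (algebraMap ℤ (𝓞 K)) p = Ideal.span {3} := by
      simp [p, Ideal.map_span]
    rw [← map_ofNat (algebraMap (𝓞 K) K) 3, this,
      Ideal.IsDedekindDomain.ramificationIdx'_eq_multiplicity (by rw [hmap]; simp) hPprime, hmap]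
  · intro x y hxy
    by_cases hy : y = 0
    · subst hy
      have : x = 0 := by simpa using hxy
      simp [this]
    have hvy : w.valuation K y ≠ 0 := (Valuation.ne_zero_iff _).2 hy
    set z := x / y with hz
    have hvz : w.valuation K z ≤ 1 := by
      rw [hz, map_div₀]; exact div_le_one_of_le₀ hxy zero_le
    have hkey : w.valuation K (1 + z ^ 2) = 1 := by
      obtain ⟨a, ha⟩ := w.exists_valuation_sub_lt_of_integer hvz 1
      rw [Units.val_one] at ha
      have hva : w.valuation K (algebraMap (𝓞 K) K a) ≤ 1 := w.valuation_le_one a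
      have h1 : w.valuation K (1 + (algebraMap (𝓞 K) K a) ^ 2) = 1 := by
        have := (w.valuation_eq_one_iff_notMem (K := K) (r := 1 + a ^ 2)).2 (hsq a)
        simpa using this
      have h2 : w.valuation K (z ^ 2 - (algebraMap (𝓞 K) K a) ^ 2) < 1 := by
        rw [show z ^ 2 - (algebraMap (𝓞 K) K a) ^ 2 = -((algebraMap (𝓞 K) K a) - z) *
          (z + algebraMap (𝓞 K) K a) by ring, map_mul, Valuation.map_neg]
        exact mul_lt_one_of_lt_of_le ha ((Valuation.map_add _ _ _).trans (max_le hvz hva))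
      rw [show 1 + z ^ 2 = (1 + (algebraMap (𝓞 K) K a) ^ 2) +
        (z ^ 2 - (algebraMap (𝓞 K) K a) ^ 2) by ring,
        Valuation.map_add_eq_of_lt_left _ (by rw [h1]; exact h2), h1]
    rw [show x ^ 2 + y ^ 2 = y ^ 2 * (1 + z ^ 2) by rw [hz]; field_simp; ring, map_mul, hkey,
      map_pow, mul_one]

/-- The inequalities satisfied by the values of the coordinates of a common zero force them to
vanish. -/
theorem values_eq_zero {Γ : Type*} [LinearOrderedCommGroupWithZero Γ] {t A B M k : Γ}
    (ht0 : 0 < t) (ht1 : t < 1) (hpar : ∀ x y : Γ, t * x ^ 2 = y ^ 2 → y = 0)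
    (hA : A ^ 2 ≤ t * (M * max M k)) (hB : B ^ 2 ≤ M * max M k)
    (hM : M ^ 2 ≤ max (max (t * M ^ 2) (t * k ^ 2)) (A * B))
    (hk : t * k ^ 2 ≤ max (M ^ 2) (A * B)) : M = 0 ∧ k = 0 ∧ A = 0 ∧ B = 0 := by
  have hAB : (A * B) ^ 2 ≤ t * (M * max M k) ^ 2 := by
    calc (A * B) ^ 2 = A ^ 2 * B ^ 2 := mul_pow _ _ _
      _ ≤ (t * (M * max M k)) * (M * max M k) := mul_le_mul' hA hB
      _ = _ := by rw [mul_assoc, ← sq]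
  rcases eq_or_ne M 0 with h0 | h0
  · subst h0
    simp only [zero_mul, mul_zero, le_zero_iff, pow_eq_zero_iff, ne_eq, OfNat.ofNat_ne_zero,
      not_false_eq_true] at hA hB
    subst hA hB
    have : t * k ^ 2 = 0 := by simpa using hk
    have : k = 0 := by simpa [ht0.ne'] using this
    exact ⟨rfl, this, rfl, rfl⟩
  exfalso
  have hMpos : 0 < M := zero_lt_iff.2 h0
  have hM2 : 0 < M ^ 2 := pow_pos hMpos 2
  have hMt : t * M ^ 2 < M ^ 2 := mul_lt_of_lt_one_left hM2 ht1
  rcases le_or_gt k M with hkM | hkM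
  · rw [max_eq_left hkM] at hAB
    have h1 : A * B < M ^ 2 := by
      refine lt_of_pow_lt_pow_left₀ 2 zero_le (hAB.trans_lt ?_)
      rw [← sq]
      exact mul_lt_of_lt_one_left (pow_pos hM2 2) ht1
    have h2 : t * k ^ 2 < M ^ 2 :=
      lt_of_le_of_lt (mul_le_mul_right (pow_le_pow_left₀ zero_le hkM 2) t) hMt
    exact absurd hM (not_le.2 (max_lt (max_lt hMt h2) h1))
  · rw [max_eq_right hkM.le] at hAB
    have hAB' : (A * B) ^ 2 ≤ M ^ 2 * (t * k ^ 2) := hAB.trans_eq (by rw [mul_pow, mul_left_comm])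
    have hkpos : 0 < k := hMpos.trans hkM
    have htk : 0 < t * k ^ 2 := mul_pos ht0 (pow_pos hkpos 2)
    have h1 : M ^ 2 ≤ t * k ^ 2 := by
      rcases le_max_iff.1 hM with h | h
      · rcases le_max_iff.1 h with h | h
        · exact absurd h (not_le.2 hMt)
        · exact h
      · have := (pow_le_pow_left₀ zero_le h 2).trans hAB'
        rw [sq (M ^ 2)] at this
        exact le_of_mul_le_mul_left this hM2
    have h2 : M ^ 2 < t * k ^ 2 := lt_of_le_of_ne h1 fun h => h0 (hpar k M h.symm)
    have h3 : A * B < t * k ^ 2 := by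
      refine lt_of_pow_lt_pow_left₀ 2 zero_le (hAB'.trans_lt ?_)
      rw [sq (t * k ^ 2)]
      exact mul_lt_mul_of_pos_right h2 htk
    exact absurd hk (not_le.2 (max_lt h2 h3))

/-- There is no common zero over a number field of odd degree if `3 ∤ d`. -/
theorem eq_zero_of_odd_finrank {d : ℤ} (hd : ¬ 3 ∣ d) (K : Type) [Field K] [NumberField K]
    (hodd : Odd (Module.finrank ℚ K)) (u : Fin 5 → K) (h0 : Q0 d u = 0) (hinf : Qinf d u = 0) :
    u = 0 := by
  obtain ⟨v, ⟨e, he, hv3⟩, hvint, hvsq⟩ := exists_valuation_three_odd K hodd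
  simp only [Q0, Qinf] at h0 hinf
  have ht0 : (0 : ℤᵐ⁰) < v 3 := by rw [hv3]; exact exp_pos
  have ht1 : v 3 < 1 := by
    rw [hv3, ← exp_zero, exp_lt_exp]
    have := he.pos
    omega
  have hpar : ∀ x y : ℤᵐ⁰, v 3 * x ^ 2 = y ^ 2 → y = 0 := by
    intro x y h
    by_contra hy
    have hx : x ≠ 0 := by
      rintro rfl
      exact hy (by simpa using h.symm)
    rw [hv3, ← exp_log hx, ← exp_log hy, ← exp_nsmul, ← exp_nsmul, ← exp_add, exp_inj] at h
    obtain ⟨k, rfl⟩ := he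
    simp only [nsmul_eq_mul] at h
    push_cast at h
    omega
  have hvd : v (d : K) = 1 := hvint d hd
  have hv2 : v (2 : K) = 1 := by exact_mod_cast hvint 2 (by norm_num)
  have hvA : v (u 0 ^ 2 - 3 * u 1 ^ 2) = max (v (u 0) ^ 2) (v 3 * v (u 1) ^ 2) := by
    by_cases h : v 3 * v (u 1) ^ 2 = v (u 0) ^ 2
    · have h1 := hpar _ _ h
      have h2 : v (u 1) = 0 := by
        rw [h1] at h
        simpa [ht0.ne'] using h
      have h1' : u 0 = 0 := by simpa using h1
      have h2' : u 1 = 0 := by simpa using h2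
      simp [h1', h2']
    · have := v.map_add_of_distinct_val (x := u 0 ^ 2) (y := - (3 * u 1 ^ 2))
        (by simpa [Valuation.map_neg] using fun h' => h h'.symm)
      simpa [sub_eq_add_neg, Valuation.map_neg] using this
  set a := u 2 with ha
  set b := u 3 with hb
  set c := u 2 + u 4 with hc
  have hc' : u 4 = c - a := by rw [hc]; ring
  rw [hc'] at h0 hinf
  set M := max (v a) (v c) with hMdef
  have haM : v a ≤ M := le_max_left _ _
  have hcM : v c ≤ M := le_max_right _ _
  have hac : v (a ^ 2 + c ^ 2) = M ^ 2 := by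
    rcases le_total (v a) (v c) with h | h
    · rw [hvsq a c h, hMdef, max_eq_right h]
    · rw [add_comm, hvsq c a h, hMdef, max_eq_left h]
  have hE1 : v 3 * v (a ^ 2 + 2 * (a * b) - b * c) ≤ v 3 * (M * max M (v b)) := by
    refine mul_le_mul_right ?_ _
    refine (v.map_sub _ _).trans (max_le ((v.map_add _ _).trans (max_le ?_ ?_)) ?_)
    · rw [map_pow, sq]
      exact mul_le_mul' haM (haM.trans (le_max_left _ _))
    · rw [map_mul, map_mul, hv2, one_mul]
      exact mul_le_mul' haM (le_max_right _ _)
    · rw [map_mul, mul_comm]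
      exact mul_le_mul' hcM (le_max_right _ _)
  have hE2 : max (v (u 0) ^ 2) (v 3 * v (u 1) ^ 2) ≤ v 3 * (M * max M (v b)) := by
    refine le_trans (le_of_eq ?_) hE1
    rw [← hvA, ← one_mul (v (u 0 ^ 2 - 3 * u 1 ^ 2)), ← hvd, ← map_mul, ← map_mul]
    rw [show (d : K) * (u 0 ^ 2 - 3 * u 1 ^ 2) = -(2 * (3 * (a ^ 2 + 2 * (a * b) - b * c))) by
      linear_combination h0, Valuation.map_neg, map_mul v 2, hv2, one_mul]
  have hvx : v (2 * d * u 0 * u 1) = v (u 0) * v (u 1) := by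
    rw [map_mul, map_mul, map_mul, hv2, hvd, one_mul, one_mul]
  have hpow (x : K) : v (3 * x ^ 2) = v 3 * v x ^ 2 := by rw [map_mul, map_pow]
  obtain ⟨h1, h2, h3, h4⟩ := values_eq_zero (k := v b) (M := M) ht0 ht1 hpar
    ((le_max_left _ _).trans hE2)
    (le_of_mul_le_mul_left ((le_max_right _ _).trans hE2) ht0)
    (by
      refine hac.symm.le.trans ?_
      rw [show a ^ 2 + c ^ 2 = 3 * a ^ 2 - 3 * b ^ 2 - 2 * d * u 0 * u 1 by
        linear_combination -hinf]
      refine (v.map_sub _ _).trans (max_le_max ((v.map_sub _ _).trans (max_le_max ?_ ?_)) hvx.le)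
      · rw [hpow]
        exact mul_le_mul_right (pow_le_pow_left₀ zero_le haM 2) _
      · rw [hpow])
    (by
      rw [← hpow, show 3 * b ^ 2 = (3 * a ^ 2 - (a ^ 2 + c ^ 2)) - 2 * d * u 0 * u 1 by
        linear_combination -hinf]
      refine (v.map_sub _ _).trans (max_le_max ((v.map_sub _ _).trans (max_le ?_ hac.le)) hvx.le)
      rw [hpow]
      exact (mul_le_of_le_one_left' ht1.le).trans (pow_le_pow_left₀ zero_le haM 2))
  have hva : a = 0 := by simpa using haM.trans h1.le
  have hvc : c = 0 := by simpa using hcM.trans h1.le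
  have hvb : b = 0 := by simpa using h2
  have hv0 : u 0 = 0 := by simpa using h3
  have hv1 : u 1 = 0 := by simpa using h4
  funext i
  fin_cases i
  · exact hv0
  · exact hv1
  · exact hva
  · exact hvb
  · change u 4 = 0
    rw [hc', hva, hvc, sub_zero]

/-- All degrees of closed points are even if `3 ∤ d`. -/
theorem two_dvd_of_mem_degrees {d : ℤ} (hd : ¬ 3 ∣ d) {n : ℕ} (hn : n ∈ Degrees d) : 2 ∣ n := by
  obtain ⟨K, _, alg, _, rfl, x, hx, h0, hinf⟩ := hn
  have : CharZero K := algebraRat.charZero K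
  obtain rfl : alg = DivisionRing.toRatAlgebra := Subsingleton.elim _ _
  have : NumberField K := ⟨⟩
  by_contra h
  exact hx (eq_zero_of_odd_finrank hd K (by simpa [Nat.odd_iff] using h) x h0 hinf)

end

/-- An integral quadratic form vanishes on a rank-two sublattice. -/
def VanishesOnPlane (Φ : (Fin 5 → ℤ) → ℤ) : Prop :=
  ∃ v w : Fin 5 → ℤ, (∀ a b : ℤ, a • v + b • w = 0 → a = 0 ∧ b = 0) ∧
    ∀ a b : ℤ, Φ (a • v + b • w) = 0

theorem VanishesOnPlane.transfer {Φ Ψ : (Fin 5 → ℤ) → ℤ} (h : VanishesOnPlane Φ)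
    (L : (Fin 5 → ℤ) →ₗ[ℤ] (Fin 5 → ℤ)) (hL : ∀ u, L u = 0 → u = 0)
    (hΨ : ∀ u, Φ u = 0 → Ψ (L u) = 0) : VanishesOnPlane Ψ := by
  obtain ⟨v, w, hind, hv⟩ := h
  refine ⟨L v, L w, fun a b hab => hind a b (hL _ ?_), fun a b => ?_⟩
  · rwa [map_add, map_smul, map_smul]
  · have := hΨ _ (hv a b)
    rwa [map_add, map_smul, map_smul] at this

/-- Two vectors with a nonzero minor spanning an isotropic plane can be saturated at a prime. -/
theorem exists_saturated {Φ : (Fin 5 → ℤ) → ℤ} (q : ℕ) [hq : Fact q.Prime]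
    (hΦ : ∀ x : Fin 5 → ℤ, Φ ((q : ℤ) • x) = (q : ℤ) ^ 2 * Φ x) (i j : Fin 5) (N : ℕ) :
    ∀ v w : Fin 5 → ℤ, (v i * w j - v j * w i).natAbs = N → v i * w j - v j * w i ≠ 0 →
      (∀ a b : ℤ, Φ (a • v + b • w) = 0) →
      ∃ v' w' : Fin 5 → ℤ, (∀ a b : ℤ, (∀ l, (q : ℤ) ∣ a * v' l + b * w' l) →
        (q : ℤ) ∣ a ∧ (q : ℤ) ∣ b) ∧ ∀ a b : ℤ, Φ (a • v' + b • w') = 0 := by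
  have hq0 : (q : ℤ) ≠ 0 := by exact_mod_cast hq.out.ne_zero
  have hqp : Prime (q : ℤ) := Nat.prime_iff_prime_int.1 hq.out
  induction N using Nat.strong_induction_on with
  | _ N ih =>
  have key : ∀ v w : Fin 5 → ℤ, (v i * w j - v j * w i).natAbs = N →
      v i * w j - v j * w i ≠ 0 → (∀ a b : ℤ, Φ (a • v + b • w) = 0) → ∀ a b : ℤ,
      (∀ l, (q : ℤ) ∣ a * v l + b * w l) → ¬ (q : ℤ) ∣ a →
      ∃ v' w' : Fin 5 → ℤ, (∀ a b : ℤ, (∀ l, (q : ℤ) ∣ a * v' l + b * w' l) →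
        (q : ℤ) ∣ a ∧ (q : ℤ) ∣ b) ∧ ∀ a b : ℤ, Φ (a • v' + b • w') = 0 := by
    intro v w hN h0 hv a b hab ha
    obtain ⟨m, n, hmn⟩ := (hqp.coprime_iff_not_dvd.2 ha)
    have hdiv : ∀ l, (q : ℤ) ∣ v l + (n * b) * w l := fun l => by
      obtain ⟨c, hc⟩ := hab l
      exact ⟨n * c + m * v l, by linear_combination n * hc - v l * hmn⟩
    choose x hx using hdiv
    have hmin : v i * w j - v j * w i = q * (x i * w j - x j * w i) := by
      linear_combination w j * hx i - w i * hx j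
    have hx0 : x i * w j - x j * w i ≠ 0 := fun h => h0 (by rw [hmin, h, mul_zero])
    refine ih (x i * w j - x j * w i).natAbs ?_ x w rfl hx0 ?_
    · rw [← hN, hmin, Int.natAbs_mul, Int.natAbs_natCast]
      exact lt_mul_of_one_lt_left (Int.natAbs_pos.2 hx0) hq.out.one_lt
    · intro e f
      have h1 := hv e (e * (n * b) + q * f)
      have h2 : e • v + (e * (n * b) + q * f) • w = (q : ℤ) • (e • x + f • w) := by
        funext l
        simp only [Pi.add_apply, Pi.smul_apply, smul_eq_mul]
        linear_combination e * hx l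
      rw [h2, hΦ] at h1
      exact (mul_eq_zero.1 h1).resolve_left (pow_ne_zero 2 hq0)
  intro v w hN h0 hv
  by_contra hcon
  push Not at hcon
  obtain ⟨a, b, hab, hnot, -⟩ : ∃ a b : ℤ, (∀ l, (q : ℤ) ∣ a * v l + b * w l) ∧
      ((q : ℤ) ∣ a → ¬ (q : ℤ) ∣ b) ∧ True := by
    by_contra! h
    obtain ⟨a, b, hab⟩ := hcon v w (fun a b hl => by
      have := h a b hl
      tauto)
    exact hab (hv a b)
  by_cases ha : (q : ℤ) ∣ a
  · obtain ⟨v', w', h1, h2⟩ := key w v (by rw [← hN, ← Int.natAbs_neg]; congr 1; ring)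
      (fun h => h0 (by linear_combination -h)) (fun e f => by rw [add_comm]; exact hv f e) b a
      (fun l => by rw [add_comm]; exact hab l) (hnot ha)
    obtain ⟨a, b, hab⟩ := hcon v' w' h1
    exact hab (h2 a b)
  · obtain ⟨v', w', h1, h2⟩ := key v w hN h0 hv a b hab ha
    obtain ⟨a, b, hab⟩ := hcon v' w' h1
    exact hab (h2 a b)

/-- Reduction of an isotropic plane modulo a prime: it is still a plane, and each of its vectors
lifts to an integral isotropic vector. -/
theorem VanishesOnPlane.exists_reduction {Φ : (Fin 5 → ℤ) → ℤ} (h : VanishesOnPlane Φ) (q : ℕ)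
    [hq : Fact q.Prime] (hΦ : ∀ x : Fin 5 → ℤ, Φ ((q : ℤ) • x) = (q : ℤ) ^ 2 * Φ x) :
    ∃ v w : Fin 5 → ZMod q, (∀ a b : ZMod q, (∀ l, a * v l + b * w l = 0) → a = 0 ∧ b = 0) ∧
      ∀ a b : ZMod q, ∃ x : Fin 5 → ℤ, (∀ l, (x l : ZMod q) = a * v l + b * w l) ∧ Φ x = 0 := by
  obtain ⟨v, w, hind, hv⟩ := h
  obtain ⟨i, j, hij⟩ : ∃ i j, v i * w j - v j * w i ≠ 0 := by
    by_contra! hall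
    have hv0 : ∀ i, v i = 0 := fun i => by
      have := (hind (w i) (-v i) (by
        funext l
        simp only [Pi.add_apply, Pi.smul_apply, smul_eq_mul, Pi.zero_apply]
        linear_combination -hall i l)).2
      simpa using this
    have := (hind 1 0 (by funext l; simp [hv0])).1
    exact one_ne_zero this
  obtain ⟨v', w', h1, h2⟩ := exists_saturated q hΦ i j _ v w rfl hij hv
  refine ⟨fun l => v' l, fun l => w' l, fun a b hab => ?_, fun a b => ?_⟩
  · obtain ⟨a, rfl⟩ := ZMod.intCast_surjective a
    obtain ⟨b, rfl⟩ := ZMod.intCast_surjective b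
    have := h1 a b fun l => by
      rw [← ZMod.intCast_zmod_eq_zero_iff_dvd]
      simpa using hab l
    simpa [ZMod.intCast_zmod_eq_zero_iff_dvd] using this
  · obtain ⟨a, rfl⟩ := ZMod.intCast_surjective a
    obtain ⟨b, rfl⟩ := ZMod.intCast_surjective b
    exact ⟨a • v' + b • w', fun l => by simp, h2 a b⟩

/-- In a plane, any linear functional vanishes on some nonzero vector. -/
theorem exists_combination_eq_zero {k : Type*} [Field k] (x y : k) :
    ∃ a b : k, (a ≠ 0 ∨ b ≠ 0) ∧ a * x + b * y = 0 := by
  by_cases hx : x = 0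
  · exact ⟨1, 0, Or.inl one_ne_zero, by simp [hx]⟩
  · exact ⟨y, -x, Or.inr (neg_ne_zero.2 hx), by ring⟩

/-- A nondegenerate diagonal quaternary form with a totally isotropic plane has square
discriminant. -/
theorem isSquare_of_diagonal_plane {k : Type*} [Field k] (c v w : Fin 4 → k)
    (hind : ∀ a b : k, (∀ l, a * v l + b * w l = 0) → a = 0 ∧ b = 0)
    (hvv : c 0 * v 0 ^ 2 + c 1 * v 1 ^ 2 + c 2 * v 2 ^ 2 + c 3 * v 3 ^ 2 = 0)
    (hww : c 0 * w 0 ^ 2 + c 1 * w 1 ^ 2 + c 2 * w 2 ^ 2 + c 3 * w 3 ^ 2 = 0)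
    (hvw : c 0 * (v 0 * w 0) + c 1 * (v 1 * w 1) + c 2 * (v 2 * w 2) + c 3 * (v 3 * w 3) = 0) :
    IsSquare (c 0 * c 1 * c 2 * c 3) := by
  have key : ∀ A B p q : k, A * p ^ 2 = B * q ^ 2 → p ≠ 0 ∨ q ≠ 0 → IsSquare (A * B) := by
    rintro A B p q h (hp | hq)
    · exact ⟨B * q / p, by field_simp; linear_combination B * h⟩
    · exact ⟨A * p / q, by field_simp; linear_combination -A * h⟩
  have h1 : c 0 * c 1 * (v 0 * w 1 - v 1 * w 0) ^ 2 = c 2 * c 3 * (v 2 * w 3 - v 3 * w 2) ^ 2 := by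
    linear_combination (c 0 * w 0 ^ 2 + c 1 * w 1 ^ 2) * hvv - (c 2 * v 2 ^ 2 + c 3 * v 3 ^ 2) * hww
      - (c 0 * v 0 * w 0 + c 1 * v 1 * w 1 - c 2 * v 2 * w 2 - c 3 * v 3 * w 3) * hvw
  have h2 : c 0 * c 2 * (v 0 * w 2 - v 2 * w 0) ^ 2 = c 1 * c 3 * (v 1 * w 3 - v 3 * w 1) ^ 2 := by
    linear_combination (c 0 * w 0 ^ 2 + c 2 * w 2 ^ 2) * hvv - (c 1 * v 1 ^ 2 + c 3 * v 3 ^ 2) * hww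
      - (c 0 * v 0 * w 0 + c 2 * v 2 * w 2 - c 1 * v 1 * w 1 - c 3 * v 3 * w 3) * hvw
  have h3 : c 0 * c 3 * (v 0 * w 3 - v 3 * w 0) ^ 2 = c 1 * c 2 * (v 1 * w 2 - v 2 * w 1) ^ 2 := by
    linear_combination (c 0 * w 0 ^ 2 + c 3 * w 3 ^ 2) * hvv - (c 1 * v 1 ^ 2 + c 2 * v 2 ^ 2) * hww
      - (c 0 * v 0 * w 0 + c 3 * v 3 * w 3 - c 1 * v 1 * w 1 - c 2 * v 2 * w 2) * hvw
  by_contra hsq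
  have n1 := mt (key _ _ _ _ h1) (fun h => hsq (by convert h using 1; ring))
  have n2 := mt (key _ _ _ _ h2) (fun h => hsq (by convert h using 1; ring))
  have n3 := mt (key _ _ _ _ h3) (fun h => hsq (by convert h using 1; ring))
  push Not at n1 n2 n3
  have hv0 : ∀ i, v i = 0 := fun i => by
    have := (hind (w i) (-v i) fun l => by
      fin_cases i <;> fin_cases l <;> grind).2
    simpa using this
  exact one_ne_zero (hind 1 0 fun l => by simp [hv0]).1

/-- A ternary form vanishing on a plane is degenerate. -/
theorem ternary_plane {k : Type*} [Field k] {A B C D E F : k} (h2 : (2 : k) ≠ 0)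
    (hdet : 4 * A * B * C + D * E * F - A * F ^ 2 - B * E ^ 2 - C * D ^ 2 ≠ 0) (v w : Fin 3 → k)
    (T : k → k → k → k) (hT : ∀ x y z, T x y z =
      A * x ^ 2 + B * y ^ 2 + C * z ^ 2 + D * x * y + E * x * z + F * y * z)
    (h : ∀ a b : k, T (a * v 0 + b * w 0) (a * v 1 + b * w 1) (a * v 2 + b * w 2) = 0) :
    ∃ a b : k, (a ≠ 0 ∨ b ≠ 0) ∧ ∀ l, a * v l + b * w l = 0 := by
  have h10 := h 1 0
  have h01 := h 0 1
  have h11 := h 1 1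
  simp only [hT] at h10 h01 h11
  have hvv : 2 * A * v 0 ^ 2 + 2 * B * v 1 ^ 2 + 2 * C * v 2 ^ 2 + 2 * D * v 0 * v 1 +
      2 * E * v 0 * v 2 + 2 * F * v 1 * v 2 = 0 := by linear_combination 2 * h10
  have hww : 2 * A * w 0 ^ 2 + 2 * B * w 1 ^ 2 + 2 * C * w 2 ^ 2 + 2 * D * w 0 * w 1 +
      2 * E * w 0 * w 2 + 2 * F * w 1 * w 2 = 0 := by linear_combination 2 * h01
  have hvw : 2 * A * v 0 * w 0 + 2 * B * v 1 * w 1 + 2 * C * v 2 * w 2 +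
      D * (v 0 * w 1 + v 1 * w 0) + E * (v 0 * w 2 + v 2 * w 0) +
      F * (v 1 * w 2 + v 2 * w 1) = 0 := by linear_combination h11 - h10 - h01
  have hp0 : v 1 * w 2 - v 2 * w 1 = 0 := by
    have : 2 * (4 * A * B * C + D * E * F - A * F ^ 2 - B * E ^ 2 - C * D ^ 2) *
        (v 1 * w 2 - v 2 * w 1) ^ 2 = 0 := by
      linear_combination (2 * A * (2 * A * w 0 ^ 2 + 2 * B * w 1 ^ 2 + 2 * C * w 2 ^ 2 +
        2 * D * w 0 * w 1 + 2 * E * w 0 * w 2 + 2 * F * w 1 * w 2) - (2 * A * w 0 + D * w 1 + E *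
          w 2) ^ 2) * hvv -
        (2 * A * v 0 + D * v 1 + E * v 2) ^ 2 * hww + (2 * (2 * A * v 0 + D * v 1 + E * v 2) * (2 *
          A * w 0 + D * w 1 + E * w 2) - 2 * A * (2 * A * v 0 * w 0 + 2 * B * v 1 * w 1 +
        2 * C * v 2 * w 2 + D * (v 0 * w 1 + v 1 * w 0) + E * (v 0 * w 2 + v 2 * w 0) +
        F * (v 1 * w 2 + v 2 * w 1))) * hvw
    simpa [h2, hdet] using this
  have hp1 : v 0 * w 2 - v 2 * w 0 = 0 := by
    have : 2 * (4 * A * B * C + D * E * F - A * F ^ 2 - B * E ^ 2 - C * D ^ 2) *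
        (v 0 * w 2 - v 2 * w 0) ^ 2 = 0 := by
      linear_combination (2 * B * (2 * A * w 0 ^ 2 + 2 * B * w 1 ^ 2 + 2 * C * w 2 ^ 2 +
        2 * D * w 0 * w 1 + 2 * E * w 0 * w 2 + 2 * F * w 1 * w 2) - (D * w 0 + 2 * B * w 1 + F *
          w 2) ^ 2) * hvv -
        (D * v 0 + 2 * B * v 1 + F * v 2) ^ 2 * hww + (2 * (D * v 0 + 2 * B * v 1 + F * v 2) * (D *
          w 0 + 2 * B * w 1 + F * w 2) - 2 * B * (2 * A * v 0 * w 0 + 2 * B * v 1 * w 1 +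
        2 * C * v 2 * w 2 + D * (v 0 * w 1 + v 1 * w 0) + E * (v 0 * w 2 + v 2 * w 0) +
        F * (v 1 * w 2 + v 2 * w 1))) * hvw
    simpa [h2, hdet] using this
  have hp2 : v 0 * w 1 - v 1 * w 0 = 0 := by
    have : 2 * (4 * A * B * C + D * E * F - A * F ^ 2 - B * E ^ 2 - C * D ^ 2) *
        (v 0 * w 1 - v 1 * w 0) ^ 2 = 0 := by
      linear_combination (2 * C * (2 * A * w 0 ^ 2 + 2 * B * w 1 ^ 2 + 2 * C * w 2 ^ 2 +
        2 * D * w 0 * w 1 + 2 * E * w 0 * w 2 + 2 * F * w 1 * w 2) - (E * w 0 + F * w 1 + 2 * C *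
          w 2) ^ 2) * hvv -
        (E * v 0 + F * v 1 + 2 * C * v 2) ^ 2 * hww + (2 * (E * v 0 + F * v 1 + 2 * C * v 2) * (E *
          w 0 + F * w 1 + 2 * C * w 2) - 2 * C * (2 * A * v 0 * w 0 + 2 * B * v 1 * w 1 +
        2 * C * v 2 * w 2 + D * (v 0 * w 1 + v 1 * w 0) + E * (v 0 * w 2 + v 2 * w 0) +
        F * (v 1 * w 2 + v 2 * w 1))) * hvw
    simpa [h2, hdet] using this
  by_contra! hcon
  have hv0 : ∀ i, v i = 0 := fun i => by
    by_contra hi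
    obtain ⟨l, hl⟩ := hcon (w i) (-v i) (Or.inr (neg_ne_zero.2 hi))
    exact hl (by fin_cases i <;> fin_cases l <;> grind)
  obtain ⟨l, hl⟩ := hcon 1 0 (Or.inl one_ne_zero)
  exact hl (by simp [hv0])

/-- The member of the pencil with parameters `s`, `r`, in coordinates where it is the sum of a
diagonal binary form and a ternary form. -/
def splitForm (α β s r : ℤ) (x : Fin 5 → ℤ) : ℤ :=
  α * x 0 ^ 2 + β * x 1 ^ 2 + s * (s * (6 * x 2 ^ 2 + 12 * x 2 * x 3 - 6 * x 3 * x 4) +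
    r * (2 * x 2 ^ 2 - x 4 ^ 2 - 3 * x 3 ^ 2))

theorem splitForm_smul (α β s r q : ℤ) (x : Fin 5 → ℤ) :
    splitForm α β s r (q • x) = q ^ 2 * splitForm α β s r x := by
  simp only [splitForm, Pi.smul_apply, smul_eq_mul]
  ring

theorem natCast_ne_zero_of_prime {q p : ℕ} (hq : q.Prime) (hp : p.Prime) (h : q ≠ p) :
    (p : ZMod q) ≠ 0 := by
  rw [Ne, ZMod.natCast_eq_zero_iff, Nat.prime_dvd_prime_iff_eq hq hp]
  exact h

theorem not_dvd_of_sq_dvd_mul_sq {q : ℕ} [hq : Fact q.Prime] {b x : ℤ} (hb : ¬ (q : ℤ) ^ 2 ∣ b)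
    (h : (q : ℤ) ^ 2 ∣ b * x ^ 2) : (q : ℤ) ∣ x := by
  by_contra hx
  have hc : IsCoprime ((q : ℤ) ^ 2) (x ^ 2) :=
    ((Nat.prime_iff_prime_int.1 hq.out).coprime_iff_not_dvd.2 hx).pow
  exact hb (hc.dvd_of_dvd_mul_right h)

/-- If the binary part degenerates modulo `q` together with the discriminant of the pencil on
the first pair of coordinates, then the remaining coefficient is a square modulo `q`. -/
theorem isSquare_coeff_of_plane (q : ℕ) [hq : Fact q.Prime] (hq2 : q ≠ 2) (hq3 : q ≠ 3)
    {α β s r : ℤ} (hβ : (q : ℤ) ∣ β) (hβ2 : ¬ (q : ℤ) ^ 2 ∣ β)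
    (hs : ¬ (q : ℤ) ∣ s) (hN : (q : ℤ) ∣ r ^ 2 + 3 * s ^ 2)
    (h : VanishesOnPlane (splitForm α β s r)) : IsSquare (α : ZMod q) := by
  obtain ⟨v, w, hind, hlift⟩ := h.exists_reduction q (splitForm_smul α β s r q)
  have h2 : (2 : ZMod q) ≠ 0 := by
    exact_mod_cast natCast_ne_zero_of_prime hq.out Nat.prime_two hq2
  have h3 : (3 : ZMod q) ≠ 0 := by
    exact_mod_cast natCast_ne_zero_of_prime hq.out Nat.prime_three hq3
  simp only [← ZMod.intCast_zmod_eq_zero_iff_dvd] at hβ hs hN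
  push_cast at hN
  set S : ZMod q := (s : ZMod q)
  set θ : ZMod q := r / S with hθ
  have hr : (r : ZMod q) = θ * S := by rw [hθ]; field_simp
  have hθ2 : θ ^ 2 = -3 := by
    have : S ^ 2 * (θ ^ 2 + 3) = 0 := by rw [hr] at hN; linear_combination hN
    have := (mul_eq_zero.1 this).resolve_left (pow_ne_zero 2 hs)
    linear_combination this
  have hθ0 : θ ≠ 0 := by
    rintro h0
    rw [h0] at hθ2
    exact h3 (by linear_combination hθ2)
  have hred : ∀ a b : ZMod q, (α : ZMod q) * (a * v 0 + b * w 0) ^ 2 +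
      -S ^ 2 * θ * ((a * v 4 + b * w 4) - θ * (a * v 3 + b * w 3)) ^ 2 +
      -6 * S ^ 2 * θ * ((a * v 3 + b * w 3) + θ / 3 * (a * v 2 + b * w 2)) ^ 2 +
      6 * S ^ 2 * (a * v 2 + b * w 2) ^ 2 = 0 := by
    intro a b
    obtain ⟨x, hx, hx0⟩ := hlift a b
    have := congrArg (Int.cast : ℤ → ZMod q) hx0
    simp only [splitForm] at this
    push_cast at this
    rw [hx, hx, hx, hx, hx, hβ, hr] at this
    have h33 : (3 : ZMod q) * (θ / 3) = θ := by field_simp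
    set ψ := θ / 3
    rw [← h33] at hθ2 ⊢
    rw [← h33] at this
    linear_combination this + (-3 * S ^ 2 * ψ * (a * v 3 + b * w 3) ^ 2 + 2 * S ^ 2 * (a * v 3 +
      b * w 3) * ((a * v 4 + b * w 4)) - 4 * S ^ 2 * (a * v 2 + b * w 2) * (a * v 3 + b * w 3) -
      2 * ψ * S ^ 2 * (a * v 2 + b * w 2) ^ 2) * hθ2
  have hsq := isSquare_of_diagonal_plane ![(α : ZMod q), -S ^ 2 * θ, -6 * S ^ 2 * θ, 6 * S ^ 2]
    ![v 0, v 4 - θ * v 3, v 3 + θ / 3 * v 2, v 2] ![w 0, w 4 - θ * w 3, w 3 + θ / 3 * w 2, w 2]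
    (fun a b hab => by
      have e0 := hab 0
      have e1 := hab 1
      have e2 := hab 2
      have e3 := hab 3
      simp at e0 e1 e2 e3
      have e2' : a * v 3 + b * w 3 = 0 := by linear_combination e2 - θ / 3 * e3
      have e1' : a * v 4 + b * w 4 = 0 := by linear_combination e1 + θ * e2'
      obtain ⟨x, hx, hx0⟩ := hlift a b
      have f0 := hx 0
      have f2 := hx 2
      have f3 := hx 3
      have f4 := hx 4
      rw [e0, ZMod.intCast_zmod_eq_zero_iff_dvd] at f0
      rw [e3, ZMod.intCast_zmod_eq_zero_iff_dvd] at f2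
      rw [e2', ZMod.intCast_zmod_eq_zero_iff_dvd] at f3
      rw [e1', ZMod.intCast_zmod_eq_zero_iff_dvd] at f4
      obtain ⟨y0, f0⟩ := f0
      obtain ⟨y2, f2⟩ := f2
      obtain ⟨y3, f3⟩ := f3
      obtain ⟨y4, f4⟩ := f4
      simp only [splitForm, f0, f2, f3, f4] at hx0
      have f1 : (q : ℤ) ∣ x 1 := not_dvd_of_sq_dvd_mul_sq hβ2
        ⟨-(α * y0 ^ 2 + s * (s * (6 * y2 ^ 2 + 12 * y2 * y3 - 6 * y3 * y4) +
          r * (2 * y2 ^ 2 - y4 ^ 2 - 3 * y3 ^ 2))), by linear_combination hx0⟩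
      rw [← ZMod.intCast_zmod_eq_zero_iff_dvd, hx 1] at f1
      exact hind a b fun l => by fin_cases l <;> assumption)
    (by have := hred 1 0; simp at this ⊢; linear_combination this)
    (by have := hred 0 1; simp at this ⊢; linear_combination this)
    (by
      have g1 := hred 1 0
      have g2 := hred 0 1
      have g3 := hred 1 1
      simp at g1 g2 g3 ⊢
      have : (2 : ZMod q) ≠ 0 := h2
      refine (mul_eq_zero.1 (?_ : (2 : ZMod q) * _ = 0)).resolve_left h2
      linear_combination g3 - g1 - g2)
  obtain ⟨e, he⟩ := hsq
  simp at he
  refine ⟨e / (6 * S ^ 3 * θ), ?_⟩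
  have h6 : (6 : ZMod q) ≠ 0 := by
    rw [show (6 : ZMod q) = 2 * 3 by norm_num]
    exact mul_ne_zero h2 h3
  field_simp
  linear_combination he

/-- At a prime dividing `d` but not `n`, a plane in the pencil forces `3n` to be a square. -/
theorem isSquare_three_mul_of_plane (q : ℕ) [hq : Fact q.Prime] (hq2 : q ≠ 2) (hq3 : q ≠ 3)
    (hq5 : q ≠ 5) {d n k s r : ℤ} (hd : (q : ℤ) ∣ d) (hd2 : ¬ (q : ℤ) ^ 2 ∣ d)
    (hn : ¬ (q : ℤ) ∣ n) (hsr : IsCoprime s r) (hN : r ^ 2 + 3 * s ^ 2 = 3 * n * k ^ 2)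
    {z : ZMod q} (hz : z ^ 4 - 6 * z ^ 2 - 12 * z - 3 = 0)
    (h : VanishesOnPlane (splitForm d (-3 * d * n) s r)) : IsSquare ((3 * n : ℤ) : ZMod q) := by
  have h2 : (2 : ZMod q) ≠ 0 := by
    exact_mod_cast natCast_ne_zero_of_prime hq.out Nat.prime_two hq2
  have h3 : (3 : ZMod q) ≠ 0 := by
    exact_mod_cast natCast_ne_zero_of_prime hq.out Nat.prime_three hq3
  have h5 : (5 : ZMod q) ≠ 0 := by
    exact_mod_cast natCast_ne_zero_of_prime hq.out Nat.prime_five hq5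
  have hn' : (n : ZMod q) ≠ 0 := by rwa [Ne, ZMod.intCast_zmod_eq_zero_iff_dvd]
  have hN' : (r : ZMod q) ^ 2 + 3 * (s : ZMod q) ^ 2 = 3 * n * (k : ZMod q) ^ 2 := by
    exact_mod_cast congrArg (Int.cast : ℤ → ZMod q) hN
  have hk : ∀ m : ZMod q, m ≠ 0 → 3 * (n : ZMod q) * (k : ZMod q) ^ 2 = m ^ 2 →
      IsSquare ((3 * n : ℤ) : ZMod q) := by
    intro m hm hmk
    have hk0 : (k : ZMod q) ≠ 0 := by
      rintro h0
      rw [h0] at hmk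
      exact hm (by simpa using hmk.symm)
    refine ⟨m / k, ?_⟩
    push_cast
    field_simp
    exact hmk
  by_cases hs : (s : ZMod q) = 0
  · refine hk r (fun hr => ?_) (by rw [← hN', hs]; ring)
    rw [ZMod.intCast_zmod_eq_zero_iff_dvd] at hs hr
    exact (Nat.prime_iff_prime_int.1 hq.out).not_isUnit (hsr.isUnit_of_dvd' hs hr)
  by_cases hD : (r : ZMod q) ^ 3 + 3 * r ^ 2 * s + 3 * r * s ^ 2 - 9 * s ^ 3 = 0
  · set S : ZMod q := (s : ZMod q)
    set t : ZMod q := r / S with ht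
    have hr : (r : ZMod q) = t * S := by rw [ht]; field_simp
    rw [hr] at hD hN'
    have ht3 : t ^ 3 + 3 * t ^ 2 + 3 * t = 9 := by
      have : S ^ 3 * (t ^ 3 + 3 * t ^ 2 + 3 * t - 9) = 0 := by linear_combination hD
      have := (mul_eq_zero.1 this).resolve_left (pow_ne_zero 3 hs)
      linear_combination this
    have hm : (t + 3) * (t ^ 2 + 3) = 18 := by linear_combination ht3
    have h18 : (18 : ZMod q) ≠ 0 := by
      rw [show (18 : ZMod q) = 2 * 3 * 3 by norm_num]
      exact mul_ne_zero (mul_ne_zero h2 h3) h3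
    have hm0 : t ^ 2 + 3 ≠ 0 := fun h0 => h18 (by rw [← hm, h0, mul_zero])
    have hf : (t ^ 2 + 3) * (z ^ 2 + t) ^ 2 = (6 * z + (t ^ 2 + 3)) ^ 2 := by
      linear_combination (t ^ 2 + 3) * hz + 2 * z ^ 2 * ht3
    have hzt : z ^ 2 + t ≠ 0 := by
      intro h0
      have h1 : 6 * z + (t ^ 2 + 3) = 0 := by
        rw [h0] at hf
        simpa using hf.symm
      have e1 : t = -z ^ 2 := by linear_combination h0
      rw [e1] at h1
      have h6 : (6 : ZMod q) ≠ 0 := by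
        rw [show (6 : ZMod q) = 2 * 3 by norm_num]
        exact mul_ne_zero h2 h3
      have e2 : z ^ 2 + 3 * z + 1 = 0 :=
        (mul_eq_zero.1 (by linear_combination h1 - hz : 6 * (z ^ 2 + 3 * z +
          1) = 0)).resolve_left h6
      have e3 : 3 * z + 1 = 0 := by
        refine (mul_eq_zero.1 (?_ : 5 * (3 * z + 1) = 0)).resolve_left h5
        linear_combination -h1 + (z ^ 2 - 3 * z + 8) * e2
      exact one_ne_zero (by linear_combination 9 * e2 - (3 * z + 8) * e3 : (1 : ZMod q) = 0)
    have h60 : 6 * z + (t ^ 2 + 3) ≠ 0 := by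
      intro h0
      rw [h0] at hf
      simp [hm0, hzt] at hf
    refine hk (S * ((6 * z + (t ^ 2 + 3)) / (z ^ 2 + t))) (mul_ne_zero hs (div_ne_zero h60 hzt)) ?_
    rw [← hN']
    field_simp
    linear_combination hf
  obtain ⟨v, w, hind, hlift⟩ := h.exists_reduction q (splitForm_smul _ _ s r q)
  have hd' : (d : ZMod q) = 0 := by rwa [ZMod.intCast_zmod_eq_zero_iff_dvd]
  obtain ⟨a, b, hab, hl⟩ := ternary_plane (A := 6 * (s : ZMod q) + 2 * r) (B := -3 * (r : ZMod q))
    (C := -r) (D := 12 * (s : ZMod q)) (E := 0) (F := -6 * (s : ZMod q)) h2 (fun h0 => hD (by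
      have h24 : (24 : ZMod q) ≠ 0 := by
        rw [show (24 : ZMod q) = 2 * 2 * 2 * 3 by norm_num]
        exact mul_ne_zero (mul_ne_zero (mul_ne_zero h2 h2) h2) h3
      refine (mul_eq_zero.1 (?_ : (24 : ZMod q) * _ = 0)).resolve_left h24
      linear_combination h0))
    (fun i => v i.succ.succ) (fun i => w i.succ.succ)
    (fun x y z => (s : ZMod q) * (6 * x ^ 2 + 12 * x * y - 6 * y * z) +
      r * (2 * x ^ 2 - z ^ 2 - 3 * y ^ 2)) (fun x y z => by ring) (fun a b => by
      obtain ⟨x, hx, hx0⟩ := hlift a b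
      have := congrArg (Int.cast : ℤ → ZMod q) hx0
      simp only [splitForm] at this
      push_cast at this
      rw [hx, hx, hx, hx, hx, hd'] at this
      refine (mul_eq_zero.1 (?_ : (s : ZMod q) * _ = 0)).resolve_left hs
      simp only [Fin.reduceSucc]
      linear_combination this)
  obtain ⟨x, hx, hx0⟩ := hlift a b
  have f2 := hx 2
  have f3 := hx 3
  have f4 := hx 4
  rw [show a * v 2 + b * w 2 = 0 from hl 0, ZMod.intCast_zmod_eq_zero_iff_dvd] at f2
  rw [show a * v 3 + b * w 3 = 0 from hl 1, ZMod.intCast_zmod_eq_zero_iff_dvd] at f3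
  rw [show a * v 4 + b * w 4 = 0 from hl 2, ZMod.intCast_zmod_eq_zero_iff_dvd] at f4
  obtain ⟨y2, f2⟩ := f2
  obtain ⟨y3, f3⟩ := f3
  obtain ⟨y4, f4⟩ := f4
  obtain ⟨e, he⟩ := hd
  have hq0 : (q : ℤ) ≠ 0 := by exact_mod_cast hq.out.ne_zero
  have hqp : Prime (q : ℤ) := Nat.prime_iff_prime_int.1 hq.out
  have hqe : ¬ (q : ℤ) ∣ e := fun ⟨c, hc⟩ => hd2 ⟨c, by rw [he, hc]; ring⟩
  have hdvd : (q : ℤ) ∣ e * (x 0 ^ 2 - 3 * n * x 1 ^ 2) := by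
    refine ⟨-(s * (s * (6 * y2 ^ 2 + 12 * y2 * y3 - 6 * y3 * y4) +
          r * (2 * y2 ^ 2 - y4 ^ 2 - 3 * y3 ^ 2))), mul_left_cancel₀ hq0 ?_⟩
    simp only [splitForm, f2, f3, f4, he] at hx0
    linear_combination hx0
  have hX := (hqp.dvd_or_dvd hdvd).resolve_left hqe
  rw [← ZMod.intCast_zmod_eq_zero_iff_dvd] at hX
  push_cast at hX
  have hx1 : (x 1 : ZMod q) ≠ 0 := by
    intro h1
    have h0 : (x 0 : ZMod q) = 0 := by
      rw [h1] at hX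
      simpa using hX
    rw [hx 0] at h0
    rw [hx 1] at h1
    have := hind a b fun l => by
      fin_cases l
      exacts [h0, h1, hl 0, hl 1, hl 2]
    tauto
  refine ⟨x 0 / x 1, ?_⟩
  push_cast
  field_simp
  linear_combination -hX

open NumberTheorySymbols in
/-- Reciprocity excludes the simultaneous local solubility conditions. -/
theorem jacobi_contradiction {g n D : ℕ} (e : ℤ) (hg : Odd g) (hn : Odd n) (hD : Odd D)
    (hgn : g.Coprime n) (hgD : g.Coprime D) (hnD : n.Coprime D)
    (he : e = 1 ∧ g * D % 12 = 5 ∨ e = -1 ∧ g * D % 12 = 7)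
    (h1 : J(g * (e * D) | n) = 1) (h2 : J(3 * (g * n) | D) = 1)
    (h3 : J(-1 * (3 * (e * D * n)) | g) = 1) : False := by
  have s1 : J(n | g) ^ 2 = 1 := jacobiSym.sq_one (by simpa using hgn.symm)
  have s2 : J(n | D) ^ 2 = 1 := jacobiSym.sq_one (by simpa using hnD)
  have s3 : J(D | g) ^ 2 = 1 := jacobiSym.sq_one (by simpa using hgD.symm)
  have hq : ∀ {a b : ℕ}, Odd a → Odd b →
      J(a | b) = (if a % 4 = 3 ∧ b % 4 = 3 then -1 else 1) * J(b | a) := by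
    intro a b ha hb
    split_ifs with h
    · rw [jacobiSym.quadratic_reciprocity_three_mod_four h.1 h.2]; ring
    · rw [one_mul]
      rw [Nat.odd_iff] at ha hb
      by_cases h' : a % 4 = 3
      · exact (jacobiSym.quadratic_reciprocity_one_mod_four (by omega) (Nat.odd_iff.2 ha)).symm
      · exact jacobiSym.quadratic_reciprocity_one_mod_four (by omega) (Nat.odd_iff.2 hb)
  have hneg : ∀ {b : ℕ}, Odd b → J(-1 | b) = if b % 4 = 3 then -1 else 1 := by
    intro b hb
    rw [jacobiSym.at_neg_one hb]
    split_ifs with h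
    · exact ZMod.χ₄_nat_three_mod_four h
    · rw [Nat.odd_iff] at hb
      exact ZMod.χ₄_nat_one_mod_four (by omega)
  have r1 := hq hg hn
  have r2 := hq hD hn
  have r3 := hq hg hD
  have r4 := hq (a := 3) (by decide) hD
  have r5 := hq (a := 3) (by decide) hg
  have m1 := hneg hn
  have m2 := hneg hg
  have h33 : J(g | 3) * J(D | 3) = J(((g * D % 12 : ℕ) : ℤ) | 3) := by
    rw [← jacobiSym.mul_left, jacobiSym.mod_left, ← Nat.cast_mul,
      jacobiSym.mod_left ((_ % 12 : ℕ) : ℤ)]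
    congr 1
    omega
  have j5 : J(((5 : ℕ) : ℤ) | 3) = -1 := by norm_num
  have j7 : J(((7 : ℕ) : ℤ) | 3) = 1 := by norm_num
  rw [jacobiSym.mul_left, jacobiSym.mul_left] at h1 h2 h3
  rw [jacobiSym.mul_left, jacobiSym.mul_left] at h3
  push_cast at r4 r5
  have hmod : g * D % 4 = (g % 4) * (D % 4) % 4 := Nat.mul_mod _ _ _
  rw [Nat.odd_iff] at hg hn hD
  have cg : g % 4 = 1 ∨ g % 4 = 3 := by omega
  have cn : n % 4 = 1 ∨ n % 4 = 3 := by omega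
  have cD : D % 4 = 1 ∨ D % 4 = 3 := by omega
  rcases he with ⟨rfl, hgD⟩ | ⟨rfl, hgD⟩ <;> rw [hgD] at h33 <;>
  rcases cg with cg | cg <;> rcases cn with cn | cn <;> rcases cD with cD | cD <;>
  rw [cg, cD] at hmod <;> try omega
  all_goals
    simp only [cg, cn, cD, j5, j7, jacobiSym.one_left] at *
    norm_num at r1 r2 r3 r4 r5 m1 m2
    simp only [r1, r2, r3, r4, r5, m1, m2] at h1 h2 h3
    have := congrArg₂ (· * ·) (congrArg₂ (· * ·) h1 h2) h3
    grind

open NumberTheorySymbols in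
theorem jacobiSym_eq_one_of_forall_prime {a : ℤ} {b : ℕ}
    (h : ∀ q : ℕ, q.Prime → q ∣ b → ¬ (q : ℤ) ∣ a ∧ IsSquare (a : ZMod q)) (hb : b ≠ 0) :
    J(a | b) = 1 := by
  induction b using induction_on_primes with
  | zero => exact absurd rfl hb
  | one => exact jacobiSym.one_right a
  | prime_mul p b hp ih =>
    have : Fact p.Prime := ⟨hp⟩
    have hb0 : b ≠ 0 := right_ne_zero_of_mul hb
    have : NeZero b := ⟨hb0⟩
    obtain ⟨h1, h2⟩ := h p hp (dvd_mul_right p b)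
    rw [jacobiSym.mul_right, ih (fun q hq hqb => h q hq (hqb.mul_left p)) hb0, mul_one,
      ← jacobiSym.legendreSym.to_jacobiSym, legendreSym.eq_one_iff]
    · exact h2
    · rwa [Ne, ZMod.intCast_zmod_eq_zero_iff_dvd]

theorem local_conditions_contradiction {d : ℤ} {n : ℕ} (hd : Squarefree d) (hd12 : d % 12 = 5)
    (hn : Squarefree n) (hn2 : Odd n)
    (ha : ∀ q : ℕ, q.Prime → q ∣ n → ¬ (q : ℤ) ∣ d → IsSquare (d : ZMod q))
    (hb : ∀ q : ℕ, q.Prime → (q : ℤ) ∣ d → ¬ q ∣ n → IsSquare ((3 * n : ℤ) : ZMod q))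
    (hc : ∀ q : ℕ, q.Prime → ∀ d' n' : ℤ, d = q * d' → (n : ℤ) = q * n' →
      IsSquare ((-3 * d' * n' : ℤ) : ZMod q)) : False := by
  have hn0 : n ≠ 0 := hn.ne_zero
  have hd0 : d.natAbs ≠ 0 := Int.natAbs_ne_zero.2 hd.ne_zero
  have hdN : Squarefree d.natAbs := Int.squarefree_natAbs.2 hd
  set g := n.gcd d.natAbs with hg
  obtain ⟨n₁, hn₁⟩ : g ∣ n := Nat.gcd_dvd_left _ _
  obtain ⟨D, hD⟩ : g ∣ d.natAbs := Nat.gcd_dvd_right _ _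
  have hg0 : g ≠ 0 := fun h => hn0 (by rw [hn₁, h, zero_mul])
  have hgpos : 0 < g := Nat.pos_of_ne_zero hg0
  have hn₁0 : n₁ ≠ 0 := fun h => hn0 (by rw [hn₁, h, mul_zero])
  have hD0 : D ≠ 0 := fun h => hd0 (by rw [hD, h, mul_zero])
  have hnD : n₁.Coprime D := by
    have : g * n₁.gcd D = g * 1 := by rw [← Nat.gcd_mul_left, ← hn₁, ← hD, mul_one]
    exact Nat.eq_of_mul_eq_mul_left hgpos this
  have hgn : g.Coprime n₁ := by
    rw [hn₁] at hn
    exact Nat.coprime_of_squarefree_mul hn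
  have hgD : g.Coprime D := by
    rw [hD] at hdN
    exact Nat.coprime_of_squarefree_mul hdN
  obtain ⟨e, he, hde⟩ : ∃ e : ℤ, (e = 1 ∧ g * D % 12 = 5 ∨ e = -1 ∧ g * D % 12 = 7) ∧
      d = g * (e * D) := by
    rw [← hD]
    have : (g : ℤ) * D = d.natAbs := by rw [hD]; push_cast; rfl
    rcases Int.natAbs_eq d with h | h
    · exact ⟨1, Or.inl ⟨rfl, by omega⟩, by linear_combination h - this⟩
    · exact ⟨-1, Or.inr ⟨rfl, by omega⟩, by linear_combination h + this⟩
  have hndvd : ∀ {q : ℕ}, q.Prime → (q : ℤ) ∣ d → ¬ (q : ℤ) ∣ 3 := by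
    intro q hq hqd h3
    have : q = 3 := (Nat.prime_dvd_prime_iff_eq hq Nat.prime_three).1 (by exact_mod_cast h3)
    subst this
    push_cast at hqd
    omega
  have hcop : ∀ {q a b : ℕ}, q.Prime → a.Coprime b → q ∣ a → q ∣ b → False :=
    fun hq hab h1 h2 => hq.one_lt.ne' (Nat.eq_one_of_dvd_coprimes hab h1 h2)
  have hgd : ∀ {q : ℕ}, (q : ℤ) ∣ d ↔ q ∣ g * D := by
    intro q
    rw [← hD, Int.natCast_dvd]
  have hen : ∀ {q : ℕ}, q.Prime → ¬ (q : ℤ) ∣ e := by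
    intro q hq h
    have : q ∣ e.natAbs := Int.natCast_dvd.1 h
    rcases he with ⟨rfl, -⟩ | ⟨rfl, -⟩ <;> exact hq.one_lt.ne' (by simpa using this)
  have oddg : Odd g := (Nat.odd_mul.1 (hn₁ ▸ hn2)).1
  have oddn : Odd n₁ := (Nat.odd_mul.1 (hn₁ ▸ hn2)).2
  have oddD : Odd D := by
    have : Odd (g * D) := by rw [Nat.odd_iff]; omega
    exact (Nat.odd_mul.1 this).2
  refine jacobi_contradiction e oddg oddn oddD hgn hgD hnD he ?_ ?_ ?_
  · rw [← hde]
    refine jacobiSym_eq_one_of_forall_prime (fun q hq hqn => ?_) hn₁0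
    have hqd : ¬ (q : ℤ) ∣ d := by
      rw [hgd, hq.dvd_mul]
      rintro (h | h)
      · exact hcop hq hgn h hqn
      · exact hcop hq hnD hqn h
    exact ⟨hqd, ha q hq (hn₁ ▸ hqn.mul_left g) hqd⟩
  · have h3n : (3 : ℤ) * (g * n₁) = 3 * n := by rw [hn₁]; push_cast; ring
    rw [h3n]
    refine jacobiSym_eq_one_of_forall_prime (fun q hq hqD => ?_) hD0
    have hqd : (q : ℤ) ∣ d := hgd.2 (hqD.mul_left g)
    have hqn : ¬ q ∣ n := by
      rw [hn₁, hq.dvd_mul]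
      rintro (h | h)
      · exact hcop hq hgD h hqD
      · exact hcop hq hnD h hqD
    refine ⟨fun h => ?_, hb q hq hqd hqn⟩
    rcases (Nat.prime_iff_prime_int.1 hq).dvd_or_dvd h with h | h
    · exact hndvd hq hqd h
    · exact hqn (by exact_mod_cast h)
  · refine jacobiSym_eq_one_of_forall_prime (fun q hq hqg => ?_) hg0
    have hqd : (q : ℤ) ∣ d := hgd.2 (hqg.mul_right D)
    have hqp := Nat.prime_iff_prime_int.1 hq
    refine ⟨fun h => ?_, ?_⟩
    · rw [neg_one_mul, dvd_neg] at h
      rcases hqp.dvd_or_dvd h with h | h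
      · exact hndvd hq hqd h
      rcases hqp.dvd_or_dvd h with h | h
      · rcases hqp.dvd_or_dvd h with h | h
        · exact hen hq h
        · exact hcop hq hgD hqg (by exact_mod_cast h)
      · exact hcop hq hgn hqg (by exact_mod_cast h)
    · obtain ⟨c, hc'⟩ := hqg
      have : Fact q.Prime := ⟨hq⟩
      obtain ⟨x, hx⟩ := hc q hq (c * (e * D)) (c * n₁) (by rw [hde, hc']; push_cast; ring)
        (by rw [hn₁, hc']; push_cast; ring)
      have hc0 : (c : ZMod q) ≠ 0 := by
        rw [Ne, ZMod.natCast_eq_zero_iff]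
        intro hqc
        have := hn.squarefree_of_dvd ⟨n₁, hn₁⟩
        rw [hc'] at this
        exact hq.one_lt.ne' (Nat.isUnit_iff.1 (this q (mul_dvd_mul_left q hqc)))
      refine ⟨x / c, ?_⟩
      push_cast at hx ⊢
      field_simp
      linear_combination hx

/-- The quadratic form `s Q₀ + r Q∞` of the pencil, on integral vectors. -/
def pencilForm (d s r : ℤ) (u : Fin 5 → ℤ) : ℤ :=
  s * (d * (u 0 ^ 2 - 3 * u 1 ^ 2) + 6 * u 2 ^ 2 + 6 * u 2 * u 3 - 6 * u 3 * u 4) +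
    r * (-2 * d * u 0 * u 1 + u 2 ^ 2 - 2 * u 2 * u 4 - 3 * u 3 ^ 2 - u 4 ^ 2)

theorem pencilForm_smul (d s r q : ℤ) (u : Fin 5 → ℤ) :
    pencilForm d s r (q • u) = q ^ 2 * pencilForm d s r u := by
  simp only [pencilForm, Pi.smul_apply, smul_eq_mul]
  ring

/-- The coordinate change diagonalizing the binary part of the pencil. -/
def splitMap (s r k : ℤ) : (Fin 5 → ℤ) →ₗ[ℤ] (Fin 5 → ℤ) where
  toFun u := ![s * u 0 - r * u 1, k * u 1, u 2, u 3, u 2 + u 4]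
  map_add' u v := by
    ext i
    fin_cases i <;> simp <;> ring
  map_smul' c u := by
    ext i
    fin_cases i <;> simp <;> ring

/-- Interchange of the first two coordinates, rescaling one of them. -/
def swapMap (q : ℤ) : (Fin 5 → ℤ) →ₗ[ℤ] (Fin 5 → ℤ) where
  toFun u := ![q * u 1, u 0, u 2, u 3, u 4]
  map_add' u v := by
    ext i
    fin_cases i <;> simp [mul_add]
  map_smul' c u := by
    ext i
    fin_cases i <;> simp [mul_left_comm]

theorem VanishesOnPlane.splitForm_of_pencilForm {d s r n k : ℤ} (hs : s ≠ 0) (hk : k ≠ 0)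
    (hN : r ^ 2 + 3 * s ^ 2 = 3 * n * k ^ 2) (h : VanishesOnPlane (pencilForm d s r)) :
    VanishesOnPlane (splitForm d (-3 * d * n) s r) := by
  refine h.transfer (splitMap s r k) (fun u hu => ?_) fun u hu => ?_
  · have h0 : s * u 0 - r * u 1 = 0 := congrFun hu 0
    have h1 : k * u 1 = 0 := congrFun hu 1
    have h2 : u 2 = 0 := congrFun hu 2
    have h3 : u 3 = 0 := congrFun hu 3
    have h4 : u 2 + u 4 = 0 := congrFun hu 4
    have h1' : u 1 = 0 := by simpa [hk] using h1
    have h0' : u 0 = 0 := by simpa [h1', hs] using h0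
    have h4' : u 4 = 0 := by simpa [h2] using h4
    funext i
    fin_cases i <;> assumption
  · change d * (s * u 0 - r * u 1) ^ 2 + (-3 * d * n) * (k * u 1) ^ 2 +
      s * (s * (6 * u 2 ^ 2 + 12 * u 2 * u 3 - 6 * u 3 * (u 2 + u 4)) +
        r * (2 * u 2 ^ 2 - (u 2 + u 4) ^ 2 - 3 * u 3 ^ 2)) = 0
    simp only [pencilForm] at hu
    linear_combination s * hu + d * u 1 ^ 2 * hN

theorem VanishesOnPlane.splitForm_swap {d' n' s r q : ℤ} (hq : q ≠ 0)
    (h : VanishesOnPlane (splitForm (q * d') (-3 * (q * d') * (q * n')) s r)) :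
    VanishesOnPlane (splitForm (-3 * d' * n') (q * d') s r) := by
  refine h.transfer (swapMap q) (fun u hu => ?_) fun u hu => ?_
  · have h1 : q * u 1 = 0 := congrFun hu 0
    have h0 : u 0 = 0 := congrFun hu 1
    have h2 : u 2 = 0 := congrFun hu 2
    have h3 : u 3 = 0 := congrFun hu 3
    have h4 : u 4 = 0 := congrFun hu 4
    have h1' : u 1 = 0 := by simpa [hq] using h1
    funext i
    fin_cases i <;> assumption
  · change (-3 * d' * n') * (q * u 1) ^ 2 + (q * d') * u 0 ^ 2 +
      s * (s * (6 * u 2 ^ 2 + 12 * u 2 * u 3 - 6 * u 3 * u 4) +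
        r * (2 * u 2 ^ 2 - u 4 ^ 2 - 3 * u 3 ^ 2)) = 0
    simp only [splitForm] at hu
    linear_combination hu

/-- A member of the pencil containing a rational line has parameter divisible by `3`. -/
theorem three_dvd_of_plane {d s r : ℤ} (hd : ¬ 3 ∣ d) (h : VanishesOnPlane (pencilForm d s r)) :
    3 ∣ r := by
  by_contra hr
  obtain ⟨v, w, hind, hlift⟩ := h.exists_reduction 3 (pencilForm_smul d s r _)
  have hr' : (r : ZMod 3) ≠ 0 := by
    rw [Ne, ZMod.intCast_zmod_eq_zero_iff_dvd]
    exact_mod_cast hr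
  have hd' : (d : ZMod 3) ≠ 0 := by
    rw [Ne, ZMod.intCast_zmod_eq_zero_iff_dvd]
    exact_mod_cast hd
  have h3 : (3 : ZMod 3) = 0 := rfl
  have hred : ∀ a b : ZMod 3, s * d * (a * v 0 + b * w 0) ^ 2 +
      r * (d * (a * v 0 + b * w 0) * (a * v 1 + b * w 1) - (a * v 2 + b * w 2) ^ 2 -
        (a * (v 2 + v 4) + b * (w 2 + w 4)) ^ 2) = 0 := by
    intro a b
    obtain ⟨x, hx, hx0⟩ := hlift a b
    have := congrArg (Int.cast : ℤ → ZMod 3) hx0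
    simp only [pencilForm] at this
    push_cast at this
    rw [hx, hx, hx, hx, hx] at this
    linear_combination this + (r * (d * (a * v 0 + b * w 0) * (a * v 1 + b * w 1) -
      (a * v 2 + b * w 2) ^ 2 + (a * v 3 + b * w 3) ^ 2) + s * (d * (a * v 1 + b * w 1) ^ 2 -
      2 * (a * v 2 + b * w 2) ^ 2 - 2 * (a * v 2 + b * w 2) * (a * v 3 + b * w 3) +
      2 * (a * v 3 + b * w 3) * (a * v 4 + b * w 4))) * h3
  have hsum : ∀ x y : ZMod 3, x ^ 2 + y ^ 2 = 0 → x = 0 ∧ y = 0 := by decide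
  have hac : ∀ a b : ZMod 3, a * v 0 + b * w 0 = 0 →
      a * v 2 + b * w 2 = 0 ∧ a * v 4 + b * w 4 = 0 := by
    intro a b h0
    have := hred a b
    rw [h0] at this
    obtain ⟨h1, h2⟩ := hsum (a * v 2 + b * w 2) (a * (v 2 + v 4) + b * (w 2 + w 4))
      ((mul_eq_zero.1 (by linear_combination -this :
        (r : ZMod 3) * ((a * v 2 + b * w 2) ^ 2 + (a * (v 2 + v 4) + b * (w 2 + w 4)) ^ 2)
          = 0)).resolve_left hr')
    exact ⟨h1, by linear_combination h2 - h1⟩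
  have hnot : ∀ a b : ZMod 3, a * v 0 + b * w 0 = 0 → a * v 1 + b * w 1 = 0 → a = 0 ∧ b = 0 := by
    intro a b h0 h1
    obtain ⟨h2, h4⟩ := hac a b h0
    obtain ⟨x, hx, hx0⟩ := hlift a b
    have f0 := hx 0
    have f1 := hx 1
    have f2 := hx 2
    have f4 := hx 4
    rw [h0, ZMod.intCast_zmod_eq_zero_iff_dvd] at f0
    rw [h1, ZMod.intCast_zmod_eq_zero_iff_dvd] at f1
    rw [h2, ZMod.intCast_zmod_eq_zero_iff_dvd] at f2
    rw [h4, ZMod.intCast_zmod_eq_zero_iff_dvd] at f4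
    obtain ⟨y0, f0⟩ := f0
    obtain ⟨y1, f1⟩ := f1
    obtain ⟨y2, f2⟩ := f2
    obtain ⟨y4, f4⟩ := f4
    simp only [pencilForm, f0, f1, f2, f4] at hx0
    push_cast at hx0
    have f3 : (3 : ℤ) ∣ r * x 3 ^ 2 :=
      ⟨s * (d * (y0 ^ 2 - 3 * y1 ^ 2) + 6 * y2 ^ 2 + 2 * y2 * x 3 - 2 * x 3 * y4) +
        r * (-2 * d * y0 * y1 + y2 ^ 2 - 2 * y2 * y4 - y4 ^ 2), by linarith⟩
    have f3' := Int.prime_three.dvd_of_dvd_pow ((Int.prime_three.dvd_or_dvd f3).resolve_left hr)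
    have f3'' : (x 3 : ZMod 3) = 0 := (ZMod.intCast_zmod_eq_zero_iff_dvd _ _).2 f3'
    rw [hx 3] at f3''
    exact hind a b fun l => by fin_cases l <;> assumption
  obtain ⟨a, b, hab, h0⟩ := exists_combination_eq_zero (v 0) (w 0)
  have h1 : a * v 1 + b * w 1 ≠ 0 := fun h1 => by
    have := hnot a b h0 h1
    tauto
  obtain ⟨h2, h4⟩ := hac a b h0
  have hall : ∀ a' b' : ZMod 3, a' * v 0 + b' * w 0 = 0 := by
    intro a' b'
    have e1 := hred a' b'
    have e2 := hred (a + a') (b + b')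
    have : (r * d * (a * v 1 + b * w 1) : ZMod 3) * (a' * v 0 + b' * w 0) = 0 := by
      rw [show (a + a') * v 0 + (b + b') * w 0 = a' * v 0 + b' * w 0 by linear_combination h0,
        show (a + a') * v 2 + (b + b') * w 2 = a' * v 2 + b' * w 2 by linear_combination h2,
        show (a + a') * (v 2 + v 4) + (b + b') * (w 2 + w 4) =
          a' * (v 2 + v 4) + b' * (w 2 + w 4) by linear_combination h2 + h4] at e2
      linear_combination e2 - e1
    exact (mul_eq_zero.1 this).resolve_left (mul_ne_zero (mul_ne_zero hr' hd') h1)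
  obtain ⟨a', b', hab', h1'⟩ := exists_combination_eq_zero (v 1) (w 1)
  have := hnot a' b' (hall a' b') h1'
  tauto

/-- No member of the pencil vanishes on a rational plane. -/
theorem not_vanishesOnPlane_pencilForm {d : ℤ} (hd : Squarefree d) (hd12 : d % 12 = 5)
    (hd5 : ¬ 5 ∣ d)
    (hz : ∀ q : ℕ, q.Prime → (q : ℤ) ∣ d → ∃ z : ZMod q, z ^ 4 - 6 * z ^ 2 - 12 * z - 3 = 0)
    {s r : ℤ} (hsr : IsCoprime s r) : ¬ VanishesOnPlane (pencilForm d s r) := by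
  intro h
  obtain ⟨r', rfl⟩ := three_dvd_of_plane (by omega) h
  have hs3 : ¬ 3 ∣ s := fun h3 =>
    Int.prime_three.not_isUnit (hsr.isUnit_of_dvd' h3 (dvd_mul_right 3 r'))
  have hs0 : s ≠ 0 := by
    rintro rfl
    exact hs3 (dvd_zero 3)
  have hsr' : IsCoprime s r' := hsr.of_mul_right_right
  have hpos : 0 < s ^ 2 + 3 * r' ^ 2 := by positivity
  obtain ⟨n, k, hnk, hn⟩ := Nat.sq_mul_squarefree (s ^ 2 + 3 * r' ^ 2).toNat
  have hnk' : (k : ℤ) ^ 2 * n = s ^ 2 + 3 * r' ^ 2 := by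
    rw [← Int.toNat_of_nonneg hpos.le, ← hnk]
    push_cast
    ring
  have hk0 : (k : ℤ) ≠ 0 := by
    rintro h0
    rw [h0] at hnk'
    simp at hnk'
    omega
  have hN : (3 * r') ^ 2 + 3 * s ^ 2 = 3 * n * (k : ℤ) ^ 2 := by linear_combination -3 * hnk'
  have hn3 : ¬ 3 ∣ n := by
    rintro ⟨m, rfl⟩
    exact hs3 (Int.prime_three.dvd_of_dvd_pow (⟨k ^ 2 * m - r' ^ 2, by
      push_cast at hnk'
      linear_combination -hnk'⟩ : (3 : ℤ) ∣ s ^ 2))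
  have hn2 : Odd n := by
    by_contra hodd
    rw [Nat.not_odd_iff_even] at hodd
    obtain ⟨m, rfl⟩ := hodd.two_dvd
    have hm : ¬ 2 ∣ m := by
      rintro ⟨l, rfl⟩
      have := hn 2 ⟨l, by ring⟩
      exact absurd (Nat.isUnit_iff.1 this) (by norm_num)
    have hm2 : (m : ℤ) % 2 = 1 := by omega
    have h2 : ¬ (2 ∣ s ∧ 2 ∣ r') := fun h2 =>
      Int.prime_two.not_isUnit (hsr'.isUnit_of_dvd' h2.1 h2.2)
    push_cast at hnk'
    have key : (k : ℤ) ^ 2 * (2 * m) % 8 = (s ^ 2 + 3 * r' ^ 2) % 8 := by rw [hnk']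
    have cs : s ^ 2 % 8 = 1 ∨ 2 ∣ s ∧ (s ^ 2 % 8 = 0 ∨ s ^ 2 % 8 = 4) := by
      have h8 : s % 8 = 0 ∨ s % 8 = 1 ∨ s % 8 = 2 ∨ s % 8 = 3 ∨ s % 8 = 4 ∨ s % 8 = 5 ∨
        s % 8 = 6 ∨ s % 8 = 7 := by omega
      rcases h8 with h | h | h | h | h | h | h | h <;> norm_num [pow_two, Int.mul_emod, h] <;> omega
    have cr : r' ^ 2 % 8 = 1 ∨ 2 ∣ r' ∧ (r' ^ 2 % 8 = 0 ∨ r' ^ 2 % 8 = 4) := by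
      have h8 : r' % 8 = 0 ∨ r' % 8 = 1 ∨ r' % 8 = 2 ∨ r' % 8 = 3 ∨ r' % 8 = 4 ∨ r' % 8 = 5 ∨
        r' % 8 = 6 ∨ r' % 8 = 7 := by omega
      rcases h8 with h | h | h | h | h | h | h | h <;> norm_num [pow_two, Int.mul_emod, h] <;> omega
    have ck : ((k : ℤ) ^ 2 * (2 * m)) % 8 = 2 ∨ ((k : ℤ) ^ 2 * (2 * m)) % 8 = 6 ∨
        ((k : ℤ) ^ 2 * (2 * m)) % 8 = 0 := by
      rcases Int.even_or_odd (k : ℤ) with ⟨l, hl⟩ | ⟨l, hl⟩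
      · right; right
        rw [hl, show (l + l) ^ 2 * (2 * (m : ℤ)) = 8 * (l ^ 2 * m) by ring]
        exact Int.mul_emod_right _ _
      · rw [hl, show (2 * l + 1) ^ 2 * (2 * (m : ℤ)) = 8 * ((l ^ 2 + l) * m) + 2 * m by ring]
        omega
    omega
  have hF := h.splitForm_of_pencilForm hs0 hk0 hN
  have hdq : ∀ {q : ℕ}, q.Prime → ¬ (q : ℤ) ^ 2 ∣ d := fun hq h2 =>
    (Nat.prime_iff_prime_int.1 hq).not_isUnit (hd _ (by rwa [← sq]))
  have hnq : ∀ {q : ℕ}, q.Prime → ¬ (q : ℤ) ^ 2 ∣ n := fun {q} hq h2 => by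
    have : q ^ 2 ∣ n := by exact_mod_cast h2
    exact hq.one_lt.ne' (Nat.isUnit_iff.1 (hn q (by rwa [← sq])))
  have hn23 : ∀ {q : ℕ}, q.Prime → q ∣ n → q ≠ 2 ∧ q ≠ 3 := fun {q} hq hqn => by
    constructor
    · rintro rfl
      exact Nat.not_even_iff_odd.2 hn2 (even_iff_two_dvd.2 hqn)
    · rintro rfl
      exact hn3 hqn
  have hns : ∀ {q : ℕ}, q.Prime → q ∣ n → ¬ (q : ℤ) ∣ s := fun {q} hq hqn hqs => by
    have hqp := Nat.prime_iff_prime_int.1 hq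
    have h1 : (q : ℤ) ∣ n := by exact_mod_cast hqn
    have h2 : (q : ℤ) ∣ 3 * r' := hqp.dvd_of_dvd_pow (n := 2) (by
      rw [show (3 * r') ^ 2 = 3 * n * (k : ℤ) ^ 2 - 3 * s ^ 2 by linear_combination hN]
      exact dvd_sub ((h1.mul_left 3).mul_right _) ((hqs.pow two_ne_zero).mul_left 3))
    exact hqp.not_isUnit (hsr.isUnit_of_dvd' hqs h2)
  have hnN : ∀ {q : ℕ}, q ∣ n → (q : ℤ) ∣ (3 * r') ^ 2 + 3 * s ^ 2 := fun {q} hqn => by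
    rw [hN]
    exact ((by exact_mod_cast hqn : (q : ℤ) ∣ n).mul_left 3).mul_right _
  refine local_conditions_contradiction hd hd12 hn hn2 (fun q hq hqn hqd => ?_)
    (fun q hq hqd hqn => ?_) (fun q hq d' n' hd' hn' => ?_)
  · have : Fact q.Prime := ⟨hq⟩
    obtain ⟨h2, h3⟩ := hn23 hq hqn
    have hqp := Nat.prime_iff_prime_int.1 hq
    refine isSquare_coeff_of_plane q h2 h3 ((by exact_mod_cast hqn : (q : ℤ) ∣ n).mul_left _) ?_
      (hns hq hqn) (hnN hqn) hF
    intro hdvd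
    have hc : IsCoprime ((q : ℤ) ^ 2) (-3 * d) := by
      refine ((hqp.coprime_iff_not_dvd).2 fun hh => ?_).pow_left
      rcases hqp.dvd_or_dvd hh with hh | hh
      · rw [dvd_neg] at hh
        exact h3 ((Nat.prime_dvd_prime_iff_eq hq Nat.prime_three).1 (by exact_mod_cast hh))
      · exact hqd hh
    exact hnq hq (hc.dvd_of_dvd_mul_left hdvd)
  · have : Fact q.Prime := ⟨hq⟩
    obtain ⟨z, hz⟩ := hz q hq hqd
    refine isSquare_three_mul_of_plane q ?_ ?_ ?_ hqd (hdq hq) (by exact_mod_cast hqn) hsr hN hz hF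
    · rintro rfl
      push_cast at hqd
      omega
    · rintro rfl
      push_cast at hqd
      omega
    · rintro rfl
      exact hd5 (by exact_mod_cast hqd)
  · have : Fact q.Prime := ⟨hq⟩
    have hqn : q ∣ n := Int.natCast_dvd_natCast.1 ⟨n', hn'⟩
    obtain ⟨h2, h3⟩ := hn23 hq hqn
    rw [hn', hd'] at hF
    have := hF.splitForm_swap (by exact_mod_cast hq.ne_zero)
    rw [← hd'] at this
    exact isSquare_coeff_of_plane q h2 h3 ⟨d', hd'⟩ (hdq hq) (hns hq hqn) (hnN hqn) this

theorem exists_integer_multiple (v : Fin 5 → ℚ) :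
    ∃ N : ℤ, N ≠ 0 ∧ ∃ v' : Fin 5 → ℤ, ∀ i, (v' i : ℚ) = N * v i := by
  obtain ⟨b, hb⟩ := IsLocalization.exist_integer_multiples_of_finite (nonZeroDivisors ℤ) v
  choose v' hv' using hb
  refine ⟨b, nonZeroDivisors.ne_zero b.2, v', fun i => ?_⟩
  have := hv' i
  simpa [Submonoid.smul_def] using this

theorem exists_coprime_combination_eq_zero (x y : ℤ) :
    ∃ s r : ℤ, IsCoprime s r ∧ s * x + r * y = 0 := by
  by_cases h : Int.gcd x y = 0
  · obtain ⟨rfl, rfl⟩ := Int.gcd_eq_zero_iff.1 h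
    exact ⟨1, 0, isCoprime_one_left, by simp⟩
  · obtain ⟨x', y', hxy, hx, hy⟩ := Int.exists_gcd_one (Nat.pos_of_ne_zero h)
    refine ⟨y', -x', (Int.isCoprime_iff_gcd_eq_one.2 hxy).symm.neg_right, ?_⟩
    linear_combination y' * hx - x' * hy

theorem Q0_smul (d : ℤ) {F : Type*} [Field F] (c : F) (u : Fin 5 → F) :
    Q0 d (c • u) = c ^ 2 * Q0 d u := by
  simp only [Q0, Pi.smul_apply, smul_eq_mul]
  ring

theorem Qinf_smul (d : ℤ) {F : Type*} [Field F] (c : F) (u : Fin 5 → F) :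
    Qinf d (c • u) = c ^ 2 * Qinf d u := by
  simp only [Qinf, Pi.smul_apply, smul_eq_mul]
  ring

theorem pencilForm_cast (d s r : ℤ) (u : Fin 5 → ℤ) :
    (pencilForm d s r u : ℚ) = s * Q0 d (fun i => (u i : ℚ)) + r * Qinf d (fun i => (u i : ℚ)) := by
  simp only [pencilForm, Q0, Qinf]
  push_cast
  ring

/-- A line defined over `ℚ` on which both forms are proportional to one fixed binary form,
without rational zeros, yields a totally isotropic plane of a member of the pencil. -/
theorem exists_plane_of_proportional {d : ℤ} {p q : ℚ} {v w : Fin 5 → ℚ}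
    (hvw : ∀ a b : ℚ, a • v + b • w = 0 → a = 0 ∧ b = 0)
    (h1 : Q0 d v + q * Q0 d w = 0)
    (h2 : Q0 d (v + w) - Q0 d v - Q0 d w + p * Q0 d w = 0)
    (h3 : Qinf d v + q * Qinf d w = 0)
    (h4 : Qinf d (v + w) - Qinf d v - Qinf d w + p * Qinf d w = 0) :
    ∃ s r : ℤ, IsCoprime s r ∧ VanishesOnPlane (pencilForm d s r) := by
  obtain ⟨M, hM, v', hv'⟩ := exists_integer_multiple v
  obtain ⟨N, hN, w', hw'⟩ := exists_integer_multiple w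
  have hM' : (M : ℚ) ≠ 0 := mod_cast hM
  have hN' : (N : ℚ) ≠ 0 := mod_cast hN
  obtain ⟨s, r, hsr, h⟩ := exists_coprime_combination_eq_zero (pencilForm d 1 0 w')
    (pencilForm d 0 1 w')
  have hw : (s : ℚ) * Q0 d w + r * Qinf d w = 0 := by
    have h' : (s : ℚ) * pencilForm d 1 0 w' + r * pencilForm d 0 1 w' = 0 := mod_cast h
    have hww : (fun i => (w' i : ℚ)) = (N : ℚ) • w := funext hw'
    rw [pencilForm_cast, pencilForm_cast, hww, Q0_smul, Qinf_smul] at h'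
    push_cast at h'
    refine (mul_eq_zero.1 (?_ : (N : ℚ) ^ 2 * _ = 0)).resolve_left (pow_ne_zero 2 hN')
    linear_combination h'
  refine ⟨s, r, hsr, v', w', fun a b hab => ?_, fun a b => ?_⟩
  · have := hvw (a * M) (b * N) <| funext fun i => by
      have hi : (a : ℚ) * v' i + b * w' i = 0 := by
        have := congrFun hab i
        simp only [Pi.add_apply, Pi.smul_apply, smul_eq_mul, Pi.zero_apply] at this
        exact_mod_cast this
      rw [hv', hw'] at hi
      simp only [Pi.add_apply, Pi.smul_apply, smul_eq_mul, Pi.zero_apply]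
      linear_combination hi
    simpa [hM', hN'] using this
  · have hab : (fun i => ((a • v' + b • w') i : ℚ)) = ((a : ℚ) * M) • v + ((b : ℚ) * N) • w := by
      funext i
      simp [hv', hw', mul_assoc]
    have key : ∀ x y : ℚ, (s : ℚ) * Q0 d (x • v + y • w) + r * Qinf d (x • v + y • w) = 0 := by
      intro x y
      simp only [Q0, Qinf, Pi.add_apply, Pi.smul_apply, smul_eq_mul] at h1 h2 h3 h4 hw ⊢
      linear_combination (x ^ 2 * s) * h1 + (x ^ 2 * r) * h3 + (x * y * s) * h2 +
        (x * y * r) * h4 + (y ^ 2 - q * x ^ 2 - p * x * y) * hw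
    have := pencilForm_cast d s r (a • v' + b • w')
    rw [hab, key] at this
    exact_mod_cast this

/-- A quadratic point of `X_d` is rational or yields a totally isotropic plane of a member of the
pencil. -/
theorem eq_zero_of_finrank_eq_two {d : ℤ}
    (hrat : ∀ u : Fin 5 → ℚ, Q0 d u = 0 → Qinf d u = 0 → u = 0)
    (hplane : ∀ s r : ℤ, IsCoprime s r → ¬ VanishesOnPlane (pencilForm d s r))
    (K : Type*) [Field K] [Algebra ℚ K] (hK : Module.finrank ℚ K = 2)
    (x : Fin 5 → K) (h0 : Q0 d x = 0) (hinf : Qinf d x = 0) : x = 0 := by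
  have : CharZero K := algebraRat.charZero K
  obtain ⟨α, hα⟩ : ∃ α : K, ∀ c : ℚ, algebraMap ℚ K c ≠ α := by
    by_contra! hc
    have : (⊤ : Submodule ℚ K) ≤ ℚ ∙ (1 : K) := fun α _ => by
      obtain ⟨c, rfl⟩ := hc α
      exact Submodule.mem_span_singleton.2 ⟨c, by rw [Algebra.algebraMap_eq_smul_one]⟩
    have h := finrank_span_singleton (K := ℚ) (one_ne_zero (α := K))
    rw [top_le_iff.1 this, finrank_top, hK] at h
    omega
  have hind : ∀ a b : ℚ, algebraMap ℚ K a + algebraMap ℚ K b * α = 0 → a = 0 ∧ b = 0 := by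
    intro a b hab
    have hb : b = 0 := by
      by_contra hb
      have hb' : algebraMap ℚ K b ≠ 0 := by simpa using hb
      refine hα (-a / b) ?_
      rw [map_div₀, map_neg, div_eq_iff hb']
      linear_combination -hab
    subst hb
    simpa using hab
  have hspan : ∀ y : K, ∃ a b : ℚ, y = algebraMap ℚ K a + algebraMap ℚ K b * α := by
    have hli : LinearIndependent ℚ ![(1 : K), α] := by
      rw [LinearIndependent.pair_iff]
      intro a b hab
      exact hind a b (by simpa [Algebra.smul_def] using hab)
    have htop := hli.span_eq_top_of_card_eq_finrank (by simp [hK])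
    intro y
    have hy : y ∈ Submodule.span ℚ (Set.range ![(1 : K), α]) := htop ▸ Submodule.mem_top
    simp only [Matrix.range_cons, Matrix.range_empty, Set.union_empty, Set.singleton_union] at hy
    obtain ⟨a, b, hab⟩ := Submodule.mem_span_pair.1 hy
    exact ⟨a, b, by simp [← hab, Algebra.smul_def]⟩
  obtain ⟨q, p, hpq⟩ := hspan (α ^ 2)
  choose v w hx using fun i => hspan (x i)
  have hd : (d : K) = algebraMap ℚ K d := by simp
  have e0 : algebraMap ℚ K (Q0 d v + q * Q0 d w) +
      algebraMap ℚ K (Q0 d (v + w) - Q0 d v - Q0 d w + p * Q0 d w) * α = Q0 d x := by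
    simp only [Q0, Pi.add_apply, hx, map_add, map_mul, map_sub, map_pow, map_ofNat, ← hd]
    linear_combination (-(d : K) * (algebraMap ℚ K (w 0) ^ 2 - 3 * algebraMap ℚ K (w 1) ^ 2) -
      6 * algebraMap ℚ K (w 2) ^ 2 - 6 * algebraMap ℚ K (w 2) * algebraMap ℚ K (w 3) +
      6 * algebraMap ℚ K (w 3) * algebraMap ℚ K (w 4)) * hpq
  have einf : algebraMap ℚ K (Qinf d v + q * Qinf d w) +
      algebraMap ℚ K (Qinf d (v + w) - Qinf d v - Qinf d w + p * Qinf d w) * α = Qinf d x := by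
    simp only [Qinf, Pi.add_apply, hx, map_add, map_mul, map_sub, map_neg, map_pow, map_ofNat,
      ← hd]
    linear_combination (2 * (d : K) * algebraMap ℚ K (w 0) * algebraMap ℚ K (w 1) -
      algebraMap ℚ K (w 2) ^ 2 + 2 * algebraMap ℚ K (w 2) * algebraMap ℚ K (w 4) +
      3 * algebraMap ℚ K (w 3) ^ 2 + algebraMap ℚ K (w 4) ^ 2) * hpq
  obtain ⟨h1, h2⟩ := hind _ _ (e0.trans h0)
  obtain ⟨h3, h4⟩ := hind _ _ (einf.trans hinf)
  by_cases hvw : ∀ a b : ℚ, a • v + b • w = 0 → a = 0 ∧ b = 0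
  · obtain ⟨s, r, hsr, h⟩ := exists_plane_of_proportional hvw h1 h2 h3 h4
    exact absurd h (hplane s r hsr)
  · push Not at hvw
    obtain ⟨a, b, hab, hne⟩ := hvw
    obtain ⟨e, f, u, hef, hv, hw⟩ : ∃ e f : ℚ, ∃ u : Fin 5 → ℚ, (e ≠ 0 ∨ f ≠ 0) ∧ v = e • u ∧
        w = f • u := by
      by_cases ha : a = 0
      · refine ⟨1, 0, v, Or.inl one_ne_zero, by simp, ?_⟩
        have : b ≠ 0 := hne ha
        simpa [ha, this] using hab
      · refine ⟨-b / a, 1, w, Or.inr one_ne_zero, ?_, by simp⟩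
        funext i
        have := congrFun hab i
        simp only [Pi.add_apply, Pi.smul_apply, smul_eq_mul, Pi.zero_apply] at this ⊢
        field_simp
        linear_combination this
    have hγ : algebraMap ℚ K e + algebraMap ℚ K f * α ≠ 0 := fun h => by
      have := hind e f h
      tauto
    have hxu : x = (algebraMap ℚ K e + algebraMap ℚ K f * α) • fun i => algebraMap ℚ K (u i) := by
      funext i
      simp only [hx, hv, hw, Pi.smul_apply, smul_eq_mul, map_mul]
      ring
    have hu0 : Q0 d u = 0 := by
      rw [hxu, Q0_smul, mul_eq_zero] at h0
      have := h0.resolve_left (pow_ne_zero 2 hγ)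
      apply (algebraMap ℚ K).injective
      simpa [Q0] using this
    have huinf : Qinf d u = 0 := by
      rw [hxu, Qinf_smul, mul_eq_zero] at hinf
      have := hinf.resolve_left (pow_ne_zero 2 hγ)
      apply (algebraMap ℚ K).injective
      simpa [Qinf] using this
    rw [hxu, hrat u hu0 huinf]
    ext i
    simp

theorem eq_zero_of_finrank_le_two {d : ℤ} (hd : ¬ 3 ∣ d)
    (hplane : ∀ s r : ℤ, IsCoprime s r → ¬ VanishesOnPlane (pencilForm d s r))
    (K : Type) [Field K] [Algebra ℚ K] [FiniteDimensional ℚ K] (hK : Module.finrank ℚ K ≤ 2)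
    (x : Fin 5 → K) (h0 : Q0 d x = 0) (hinf : Qinf d x = 0) : x = 0 := by
  have hodd : ∀ (L : Type) [Field L] [Algebra ℚ L] [FiniteDimensional ℚ L],
      ¬ 2 ∣ Module.finrank ℚ L → ∀ x : Fin 5 → L, Q0 d x = 0 → Qinf d x = 0 → x = 0 := by
    intro L _ _ _ hL x h0 hinf
    by_contra hx
    exact hL (two_dvd_of_mem_degrees hd ⟨L, _, _, inferInstance, rfl, x, hx, h0, hinf⟩)
  by_cases h2 : 2 ∣ Module.finrank ℚ K
  · have := Module.finrank_pos (R := ℚ) (M := K)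
    exact eq_zero_of_finrank_eq_two (hodd ℚ (by simp)) hplane K (by omega) x h0 hinf
  · exact hodd K h2 x h0 hinf

/-- A square root can be adjoined in an extension of degree dividing two. -/
theorem exists_sqrt_extension (L : Type) [Field L] [Algebra ℚ L] [FiniteDimensional ℚ L] (δ : L) :
    ∃ (K : Type) (_ : Field K) (_ : Algebra ℚ K) (_ : FiniteDimensional ℚ K) (φ : L →+* K),
      (∃ ρ : K, ρ ^ 2 = φ δ) ∧ Module.finrank ℚ K ∣ 2 * Module.finrank ℚ L := by
  by_cases h : ∃ ρ : L, ρ ^ 2 = δ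
  · obtain ⟨ρ, hρ⟩ := h
    exact ⟨L, _, _, inferInstance, RingHom.id L, ⟨ρ, hρ⟩, dvd_mul_left _ _⟩
  · have hirr : Irreducible (Polynomial.X ^ 2 - Polynomial.C δ : Polynomial L) :=
      X_pow_sub_C_irreducible_of_prime Nat.prime_two (by simpa using h)
    have : Fact (Irreducible (Polynomial.X ^ 2 - Polynomial.C δ : Polynomial L)) := ⟨hirr⟩
    let b := AdjoinRoot.powerBasis hirr.ne_zero
    have hfin : FiniteDimensional L (AdjoinRoot (Polynomial.X ^ 2 - Polynomial.C δ)) := b.finite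
    have hrank : Module.finrank L (AdjoinRoot (Polynomial.X ^ 2 - Polynomial.C δ)) = 2 := by
      rw [b.finrank, AdjoinRoot.powerBasis_dim, Polynomial.natDegree_X_pow_sub_C]
    refine ⟨AdjoinRoot (Polynomial.X ^ 2 - Polynomial.C δ), inferInstance, inferInstance,
      FiniteDimensional.trans ℚ L _, AdjoinRoot.of _,
      ⟨AdjoinRoot.root _, ?_⟩, ?_⟩
    · have := AdjoinRoot.eval₂_root (Polynomial.X ^ 2 - Polynomial.C δ)
      simpa [sub_eq_zero] using this
    · rw [← Module.finrank_mul_finrank ℚ L, hrank, mul_comm]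

theorem Qinf_map (d : ℤ) {K L : Type*} [Field K] [Field L] (φ : L →+* K) (u : Fin 5 → L) :
    Qinf d (fun i => φ (u i)) = φ (Qinf d u) := by
  simp [Qinf, map_ofNat]

theorem exists_mem_degrees_dvd_four {d : ℤ} (hd : d ≠ 0) : ∃ n ∈ Degrees d, n ∣ 4 := by
  obtain ⟨L, _, _, _, φ, ⟨ρ, hρ⟩, hL⟩ := exists_sqrt_extension ℚ 2
  obtain ⟨K, _, _, hK', ψ, ⟨σ, hσ⟩, hK⟩ := exists_sqrt_extension L (-6 * d)
  have : CharZero K := algebraRat.charZero K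
  have hd' : (d : K) ≠ 0 := mod_cast hd
  have hρ' : ψ ρ ^ 2 = 2 := by rw [← map_pow, hρ, map_ofNat, map_ofNat]
  have hσ' : σ ^ 2 = -6 * d := by simpa [map_ofNat] using hσ
  refine ⟨_, ⟨K, _, _, hK', rfl, ![σ * (1 + ψ ρ) / d, 0, 1 + ψ ρ, 0, 1], fun h => ?_, ?_, ?_⟩,
    hK.trans ((Nat.mul_dvd_mul_left 2 hL).trans (by simp))⟩
  · simpa using congrFun h 4
  · simp only [Q0, Matrix.cons_val]
    field_simp
    linear_combination (1 + ψ ρ) ^ 2 * hσ'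
  · simp only [Qinf, Matrix.cons_val]
    linear_combination hρ'

theorem int_cube_ne_hundred (y : ℤ) : y ^ 3 ≠ 100 := by
  intro h
  have : y < 5 := by nlinarith [sq_nonneg y, sq_nonneg (y + 5)]
  have : 4 < y := by nlinarith [sq_nonneg y, sq_nonneg (y + 4)]
  omega

theorem rat_cube_ne_hundred (a : ℚ) : a ^ 3 ≠ 100 := by
  intro h
  obtain ⟨y, rfl⟩ : ∃ y : ℤ, (y : ℚ) = a := by
    refine IsIntegrallyClosed.isIntegral_iff.1 (⟨Polynomial.X ^ 3 - Polynomial.C 100, ?_, ?_⟩ :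
      IsIntegral ℤ a)
    · exact Polynomial.monic_X_pow_sub_C _ (by norm_num)
    · simp [h]
  exact int_cube_ne_hundred y (mod_cast h)

theorem exists_cubic_field :
    ∃ (L : Type) (_ : Field L) (_ : Algebra ℚ L) (_ : FiniteDimensional ℚ L) (t : L),
      Module.finrank ℚ L = 3 ∧ t ^ 3 + 3 * t ^ 2 + 3 * t = 9 := by
  have hirr : Irreducible (Polynomial.X ^ 3 - Polynomial.C 10 : Polynomial ℚ) := by
    refine X_pow_sub_C_irreducible_of_prime Nat.prime_three fun b hb => ?_
    refine rat_cube_ne_hundred (b ^ 2) ?_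
    linear_combination (b ^ 3 + 10) * hb
  have : Fact (Irreducible (Polynomial.X ^ 3 - Polynomial.C 10 : Polynomial ℚ)) := ⟨hirr⟩
  let b := AdjoinRoot.powerBasis hirr.ne_zero
  refine ⟨AdjoinRoot (Polynomial.X ^ 3 - Polynomial.C (10 : ℚ)), inferInstance, inferInstance,
    b.finite, AdjoinRoot.root _ - 1, ?_, ?_⟩
  · rw [b.finrank, AdjoinRoot.powerBasis_dim, Polynomial.natDegree_X_pow_sub_C]
  · have := AdjoinRoot.eval₂_root (Polynomial.X ^ 3 - Polynomial.C (10 : ℚ))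
    rw [Polynomial.eval₂_sub, Polynomial.eval₂_pow, Polynomial.eval₂_X, Polynomial.eval₂_C] at this
    have h10 := map_ofNat (AdjoinRoot.of (Polynomial.X ^ 3 - Polynomial.C (10 : ℚ))) 10
    linear_combination this + h10

/-- The vertex of the singular member of the pencil at the parameter `t`. -/
def coneVertex {K : Type*} [Field K] (t : K) : Fin 5 → K :=
  ![0, 0, -(t * (t ^ 2 + 3)) / 6, t, -3 + t * (t ^ 2 + 3) / 6]

/-- A point on the singular member of the pencil at the parameter `t`. -/
def conePoint (d r k : ℤ) {K : Type*} [Field K] (t : K) : Fin 5 → K :=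
  ![(6 * (2 * r - 1) + (t ^ 2 + 3)) * t ^ 2 + t * (((2 * r - 1) ^ 2 + t) * t ^ 2),
    ((2 * r - 1) ^ 2 + t) * t ^ 2,
    d * k * (t ^ 2 + 3) * (3 - 3 * t - t ^ 2) / 3,
    0,
    2 * d * k * (t ^ 2 + 3) - d * k * (t ^ 2 + 3) * (3 - 3 * t - t ^ 2) / 3]

theorem cone_eq_zero {d r k : ℤ} (hk : d * k ^ 2 = -(4 * r ^ 4 - 8 * r ^ 3 - 2 * r + 1))
    {K : Type*} [Field K] [CharZero K] {t : K} (ht : t ^ 3 + 3 * t ^ 2 + 3 * t = 9) (l : K) :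
    Q0 d (conePoint d r k t + l • coneVertex t) +
      t * Qinf d (conePoint d r k t + l • coneVertex t) = 0 := by
  have hk' : (d : K) * k ^ 2 = -(4 * r ^ 4 - 8 * r ^ 3 - 2 * r + 1) :=
    mod_cast congrArg (Int.cast : ℤ → K) hk
  have h1 : Q0 d (conePoint d r k t) + t * Qinf d (conePoint d r k t) = 0 := by
    simp only [conePoint, Q0, Qinf, Matrix.cons_val]
    linear_combination (d : K) * ((6) + (-12) * r + (-48) * r ^ 3 + (24) * r ^ 4 + (-12) * t +
      (24) * t * r + (96) * t * r ^ 3 + (-48) * t * r ^ 4 + (-8) * t ^ 3 + (16) * t ^ 3 * r +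
      (64) * t ^ 3 * r ^ 3 + (-32) * t ^ 3 * r ^ 4 + (-10/3) * t ^ 4 + (32/3) * t ^ 4 * r + (-8) *
      t ^ 4 * r ^ 2 + (32/3) * t ^ 4 * r ^ 3 + (-16/3) * t ^ 4 * r ^ 4 + (-4/3) * t ^ 5 + (8/3) *
      t ^ 5 * r + (32/3) * t ^ 5 * r ^ 3 + (-16/3) * t ^ 5 * r ^ 4 + (-2/9) * t ^ 6 + (4/9) *
      t ^ 6 * r + (16/9) * t ^ 6 * r ^ 3 + (-8/9) * t ^ 6 * r ^ 4) * ht + (d : K) * ((54) +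
      (-126) * t + (18) * t ^ 2 + (-42) * t ^ 3 + (12) * t ^ 4 + (16) * t ^ 5 + (10) * t ^ 6 +
      (6) * t ^ 7 + (2) * t ^ 8 + (2/9) * t ^ 9) * hk'
  have h2 : Q0 d (conePoint d r k t + l • coneVertex t) +
      t * Qinf d (conePoint d r k t + l • coneVertex t) =
        Q0 d (conePoint d r k t) + t * Qinf d (conePoint d r k t) := by
    generalize conePoint d r k t = p
    simp only [coneVertex, Q0, Qinf, Matrix.cons_val, Pi.add_apply, Pi.smul_apply, smul_eq_mul]
    linear_combination (l * (-2 / 3 * t * p 2 - 2 * p 3) +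
      l ^ 2 * t * (t ^ 3 / 18 + t / 6 - 1)) * ht
  rw [h2, h1]

theorem conePoint_add_ne_zero {d r k : ℤ} {K : Type*} [Field K] [CharZero K] {t : K}
    (ht : t ^ 3 + 3 * t ^ 2 + 3 * t = 9) (l : K) : conePoint d r k t + l • coneVertex t ≠ 0 := by
  intro h
  have ht0 : t ≠ 0 := by
    rintro rfl
    norm_num at ht
  have h1 := congrFun h 1
  simp only [conePoint, coneVertex, Matrix.cons_val, Pi.add_apply, Pi.smul_apply, smul_eq_mul,
    mul_zero, add_zero, Pi.zero_apply, mul_eq_zero, ht0, pow_eq_zero_iff, ne_eq,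
    OfNat.ofNat_ne_zero, not_false_eq_true, or_false] at h1
  have h2 : (1 - (2 * (r : K) - 1) ^ 2) ^ 3 = 10 := by
    rw [← neg_eq_of_add_eq_zero_right h1] at ht
    linear_combination ht
  have h3 : (1 - (2 * r - 1) ^ 2) ^ 3 = 10 := mod_cast h2
  have h4 : 4 * (16 * (r - r ^ 2) ^ 3) = 10 := by linear_combination h3
  omega

theorem coneVertex_ne_zero {K : Type*} [Field K] {t : K} (ht : t ≠ 0) : coneVertex t ≠ 0 :=
  fun h => ht (by simpa [coneVertex] using congrFun h 3)

theorem exists_mem_degrees_dvd_six {d r k : ℤ}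
    (hk : d * k ^ 2 = -(4 * r ^ 4 - 8 * r ^ 3 - 2 * r + 1)) : ∃ n ∈ Degrees d, n ∣ 6 := by
  obtain ⟨L, _, _, hL, t, hL3, ht⟩ := exists_cubic_field
  have : CharZero L := algebraRat.charZero L
  have ht0 : t ≠ 0 := by
    rintro rfl
    norm_num at ht
  by_cases hA : Qinf d (coneVertex t) = 0
  · refine ⟨_, ⟨L, _, _, hL, rfl, coneVertex t, coneVertex_ne_zero ht0, ?_, hA⟩, by simp [hL3]⟩
    have : Q0 d (coneVertex t) + t * Qinf d (coneVertex t) = 0 := by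
      simp only [coneVertex, Q0, Qinf, Matrix.cons_val]
      linear_combination t * (t ^ 3 / 18 + t / 6 - 1) * ht
    simpa [hA] using this
  · obtain ⟨K, _, _, hK, φ, ⟨ρ, hρ⟩, hdvd⟩ := exists_sqrt_extension L
      ((Qinf d (conePoint d r k t + coneVertex t) - Qinf d (conePoint d r k t) -
        Qinf d (coneVertex t)) ^ 2 - 4 * Qinf d (coneVertex t) * Qinf d (conePoint d r k t))
    have : CharZero K := algebraRat.charZero K
    have ht' : φ t ^ 3 + 3 * φ t ^ 2 + 3 * φ t = 9 := by
      simpa [map_ofNat] using congrArg φ ht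
    obtain ⟨l, hl⟩ : ∃ l : K, Qinf d (conePoint d r k (φ t) + l • coneVertex (φ t)) = 0 := by
      have hv : coneVertex (φ t) = fun i => φ (coneVertex t i) := by
        funext i
        fin_cases i <;> simp [coneVertex, map_ofNat]
      have hp : conePoint d r k (φ t) = fun i => φ (conePoint d r k t i) := by
        funext i
        fin_cases i <;> simp [conePoint, map_ofNat]
      have hA' : Qinf d (coneVertex (φ t)) ≠ 0 := by
        rw [hv, Qinf_map]
        simpa using hA
      have hs : conePoint d r k (φ t) + coneVertex (φ t) =
          fun i => φ ((conePoint d r k t + coneVertex t) i) := by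
        rw [hv, hp]
        funext i
        simp
      simp only [map_sub, map_mul, map_pow, map_ofNat, ← Qinf_map, ← hv, ← hp, ← hs] at hρ
      generalize conePoint d r k (φ t) = p at *
      generalize coneVertex (φ t) = v at *
      refine ⟨(ρ - (Qinf d (p + v) - Qinf d p - Qinf d v)) / (2 * Qinf d v), ?_⟩
      have hexp : ∀ l : K, Qinf d (p + l • v) =
          Qinf d v * l ^ 2 + (Qinf d (p + v) - Qinf d p - Qinf d v) * l + Qinf d p := fun l => by
        simp only [Qinf, Pi.add_apply, Pi.smul_apply, smul_eq_mul]
        ring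
      rw [hexp]
      field_simp
      linear_combination hρ
    refine ⟨_, ⟨K, _, _, hK, rfl, _, conePoint_add_ne_zero ht' l, ?_, hl⟩,
      by simpa [hL3] using hdvd⟩
    simpa [hl] using cone_eq_zero hk ht' l

theorem dvd_two_of_forall_degrees {d r k : ℤ} (hd : d ≠ 0)
    (hk : d * k ^ 2 = -(4 * r ^ 4 - 8 * r ^ 3 - 2 * r + 1)) {m : ℕ}
    (hm : ∀ n ∈ Degrees d, m ∣ n) : m ∣ 2 := by
  obtain ⟨a, ha, ha4⟩ := exists_mem_degrees_dvd_four hd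
  obtain ⟨b, hb, hb6⟩ := exists_mem_degrees_dvd_six hk
  exact Nat.dvd_gcd ((hm a ha).trans ha4) ((hm b hb).trans hb6)

/-- The parameters `d` of the family: squarefree integers, congruent to `5` modulo `12` and prime
to `5`, whose product with a suitable square is the negative of `4r⁴ - 8r³ - 2r + 1`. -/
def parameterSet : Set ℤ :=
  {d | Squarefree d ∧ d % 12 = 5 ∧ ¬ 5 ∣ d ∧
    ∃ r k : ℤ, d * k ^ 2 = -(4 * r ^ 4 - 8 * r ^ 3 - 2 * r + 1)}

theorem exists_root_mod_of_mem_parameterSet {d : ℤ} (hd : d ∈ parameterSet) (q : ℕ)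
    (hqd : (q : ℤ) ∣ d) : ∃ z : ZMod q, z ^ 4 - 6 * z ^ 2 - 12 * z - 3 = 0 := by
  obtain ⟨-, -, -, r, k, hrk⟩ := hd
  refine ⟨2 * r - 1, ?_⟩
  have h0 : (d : ZMod q) = 0 := (ZMod.intCast_zmod_eq_zero_iff_dvd _ _).2 hqd
  have h1 := congrArg (Int.cast : ℤ → ZMod q) hrk
  push_cast at h1
  rw [h0] at h1
  linear_combination 4 * h1

theorem exists_squarefree_mul_sq (N : ℤ) :
    ∃ d k : ℤ, Squarefree d ∧ d * k ^ 2 = N := by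
  obtain ⟨a, b, hab, ha⟩ := Nat.sq_mul_squarefree N.natAbs
  have hab' : (b : ℤ) ^ 2 * a = |N| := by
    rw [Int.abs_eq_natAbs, ← hab]
    push_cast
    ring
  have ha' : Squarefree (a : ℤ) := Int.squarefree_natCast.2 ha
  rcases abs_choice N with h | h
  · exact ⟨a, b, ha', by rw [← h, ← hab']; ring⟩
  · refine ⟨-a, b, ?_, by linear_combination -hab' - h⟩
    rwa [← Int.squarefree_natAbs, Int.natAbs_neg, Int.squarefree_natAbs]

theorem emod_twelve_of_mul_sq {d k r : ℤ} (hr : r % 6 = 3)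
    (h : d * k ^ 2 = -(4 * r ^ 4 - 8 * r ^ 3 - 2 * r + 1)) : d % 12 = 5 := by
  obtain ⟨s, rfl⟩ : ∃ s, r = 6 * s + 3 := ⟨r / 6, by omega⟩
  have h1 := congrArg (Int.cast : ℤ → ZMod 12) h
  push_cast at h1
  have key : ∀ s d k : ZMod 12, d * k ^ 2 =
      -(4 * (6 * s + 3) ^ 4 - 8 * (6 * s + 3) ^ 3 - 2 * (6 * s + 3) + 1) → d = 5 := by
    decide
  have h2 : (d : ZMod 12) = (5 : ℤ) := by
    rw [key _ _ _ h1]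
    rfl
  exact (ZMod.intCast_eq_intCast_iff' d 5 12).1 h2

theorem infinite_parameterSet : parameterSet.Infinite := by
  intro hfin
  set P := ∏ d ∈ hfin.toFinset, d with hP
  have hPodd : P % 2 = 1 := by
    rw [← Int.odd_iff]
    refine Finset.prod_induction _ (fun x : ℤ => Odd x) (fun a b => Odd.mul) odd_one fun d hd => ?_
    obtain ⟨-, h, -⟩ := hfin.mem_toFinset.1 hd
    rw [Int.odd_iff]
    omega
  set r := 15 * P with hr
  obtain ⟨d, k, hd, hdk⟩ := exists_squarefree_mul_sq (-(4 * r ^ 4 - 8 * r ^ 3 - 2 * r + 1))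
  have hcop : ∀ x : ℤ, x ∣ d → x ∣ r → x ∣ 1 := fun x hx hxr => by
    have h1 : x ∣ -(4 * r ^ 4 - 8 * r ^ 3 - 2 * r + 1) := hdk ▸ hx.mul_right _
    have h2 : (1 : ℤ) = -(-(4 * r ^ 4 - 8 * r ^ 3 - 2 * r + 1)) +
        r * (-(4 * r ^ 3 - 8 * r ^ 2 - 2)) := by ring
    rw [h2]
    exact dvd_add (h1.neg_right) (hxr.mul_right _)
  have h12 : d % 12 = 5 := emod_twelve_of_mul_sq (by omega) hdk
  have hmem : d ∈ parameterSet :=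
    ⟨hd, h12, fun h5 => absurd (hcop 5 h5 (by omega)) (by norm_num), r, k, hdk⟩
  have hdP : d ∣ P := Finset.dvd_prod_of_mem (fun x => x) (hfin.mem_toFinset.2 hmem)
  rcases Int.isUnit_iff.1 (isUnit_of_dvd_one (hcop d dvd_rfl (hdP.mul_left _))) with h | h <;> omega

section

open Matrix

theorem Matrix.IsSymm.eq_zero_of_forall_dotProduct {n F : Type*} [Fintype n] [DecidableEq n]
    [Field F] [CharZero F] {A : Matrix n n F} (hA : A.IsSymm) (h : ∀ x, x ⬝ᵥ A *ᵥ x = 0) :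
    A = 0 := by
  ext i j
  have h1 := h (Pi.single i 1 + Pi.single j 1)
  have h2 := h (Pi.single i 1)
  have h3 := h (Pi.single j 1)
  simp only [Matrix.mulVec_add, Matrix.mulVec_single_one, add_dotProduct, dotProduct_add,
    single_one_dotProduct, Matrix.col_apply] at h1 h2 h3
  have h4 := hA.apply i j
  have h5 : (2 : F) * A i j = 0 := by linear_combination h1 - h2 - h3 - h4
  simpa using h5

theorem Matrix.IsSymm.det_eq_of_forall_dotProduct {n F : Type*} [Fintype n] [DecidableEq n]
    [Field F] [CharZero F] {A B M : Matrix n n F} {c : F} (hA : A.IsSymm) (hB : B.IsSymm)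
    (h : ∀ x, x ⬝ᵥ A *ᵥ x = c * ((M *ᵥ x) ⬝ᵥ B *ᵥ (M *ᵥ x))) :
    A.det = c ^ Fintype.card n * (M.det ^ 2 * B.det) := by
  have hsymm : (A - c • (Mᵀ * B * M)).IsSymm := by
    refine hA.sub (Matrix.IsSymm.smul ?_ c)
    rw [Matrix.IsSymm, Matrix.transpose_mul, Matrix.transpose_mul, Matrix.transpose_transpose,
      hB.eq, Matrix.mul_assoc]
  have h0 := hsymm.eq_zero_of_forall_dotProduct fun x => by
    rw [Matrix.sub_mulVec, dotProduct_sub, h, Matrix.smul_mulVec, dotProduct_smul, smul_eq_mul,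
      Matrix.mul_assoc, ← Matrix.mulVec_mulVec, Matrix.dotProduct_mulVec _ Mᵀ,
      Matrix.vecMul_transpose, ← Matrix.mulVec_mulVec, sub_self]
  rw [sub_eq_zero.1 h0, Matrix.det_smul, Matrix.det_mul, Matrix.det_mul, Matrix.det_transpose]
  ring

/-- The rank-four Gram matrix of the singular member of the pencil at a parameter `μ` with
`μ ^ 2 = -3`. -/
def coneGram (d : ℤ) {F : Type*} [Field F] (μ : F) : Matrix (Fin 4) (Fin 4) F :=
  !![(d : F), 0, 0, 0; 0, 6 + μ, 3, -μ; 0, 3, -3 * μ, -3; 0, -μ, -3, -μ]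

theorem isSymm_coneGram (d : ℤ) {F : Type*} [Field F] (μ : F) : (coneGram d μ).IsSymm := by
  ext i j
  fin_cases i <;> fin_cases j <;> rfl

theorem det_coneGram (d : ℤ) {F : Type*} [Field F] {μ : F} (hμ : μ ^ 2 = -3) :
    (coneGram d μ).det = -108 * d := by
  rw [coneGram, Matrix.det_succ_row_zero]
  simp [Fin.sum_univ_succ, Matrix.det_fin_three, Fin.succAbove]
  linear_combination (d : F) * (18 + 6 * μ) * hμ

/-- Projection from the vertex of the singular member at a parameter `μ` with `μ ^ 2 = -3`. -/
def coneProjection {F : Type*} [Field F] (μ : F) : Matrix (Fin 4) (Fin 5) F :=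
  !![1, -μ, 0, 0, 0; 0, 0, 1, 0, 0; 0, 0, 0, 1, 0; 0, 0, 0, 0, 1]

theorem pencil_eq_dotProduct (d : ℤ) {F : Type*} [Field F] {μ : F} (hμ : μ ^ 2 = -3)
    (u : Fin 5 → F) : Q0 d u + μ * Qinf d u =
      (coneProjection μ *ᵥ u) ⬝ᵥ coneGram d μ *ᵥ (coneProjection μ *ᵥ u) := by
  simp [Q0, Qinf, coneProjection, coneGram, Matrix.mulVec, dotProduct, Fin.sum_univ_succ]
  linear_combination (-(d : F) * u 1 ^ 2) * hμ

theorem sq_eq_neg_three_of_singular {d : ℤ} (hd : d ≠ 0) {F : Type*} [Field F] [CharZero F]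
    (hc : ∀ x : F, x ^ 3 ≠ 10) {μ : F} {w : Fin 5 → F} (hw : w ≠ 0)
    (h : ∀ y, Q0 d (y + w) + μ * Qinf d (y + w) = Q0 d y + μ * Qinf d y) : μ ^ 2 = -3 := by
  have hd' : (d : F) ≠ 0 := mod_cast hd
  have h0 := h 0
  have e0 := h ![1, 0, 0, 0, 0]
  have e1 := h ![0, 1, 0, 0, 0]
  have e2 := h ![0, 0, 1, 0, 0]
  have e3 := h ![0, 0, 0, 1, 0]
  have e4 := h ![0, 0, 0, 0, 1]
  simp only [Q0, Qinf, Pi.add_apply, Matrix.cons_val, Pi.zero_apply] at h0 e0 e1 e2 e3 e4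
  have f0 : w 0 = μ * w 1 := by
    refine mul_left_cancel₀ (mul_ne_zero two_ne_zero hd') ?_
    linear_combination e0 - h0
  have f1 : w 1 * (μ ^ 2 + 3) = 0 := by
    refine mul_left_cancel₀ (mul_ne_zero two_ne_zero hd') ?_
    linear_combination -(e1 - h0) - 2 * d * μ * f0
  rcases mul_eq_zero.1 f1 with h1 | h1
  · exfalso
    have f2 : (6 + μ) * w 2 + 3 * w 3 - μ * w 4 = 0 := by linear_combination (e2 - h0) / 2
    have f3 : w 2 - μ * w 3 - w 4 = 0 := by linear_combination (e3 - h0) / 6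
    have f4 : -3 * w 3 - μ * (w 2 + w 4) = 0 := by linear_combination (e4 - h0) / 2
    have hD : μ ^ 3 + 3 * μ ^ 2 + 3 * μ - 9 ≠ 0 := fun hD => hc (μ + 1) (by linear_combination hD)
    have g3 : w 3 = 0 := by
      refine (mul_eq_zero.1 (?_ : (μ ^ 3 + 3 * μ ^ 2 + 3 * μ - 9) * w 3 = 0)).resolve_left hD
      linear_combination 3 * (f4 - μ * f3) + μ * (f2 - μ * f3)
    have g2 : w 2 = 0 := by
      linear_combination (f2 - μ * f3 - (3 + μ ^ 2) * g3) / 6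
    refine hw (funext fun i => ?_)
    fin_cases i
    · simpa [h1] using f0
    · exact h1
    · exact g2
    · exact g3
    · change w 4 = 0
      linear_combination g2 - μ * g3 - f3
  · linear_combination h1

theorem isSquare_mul_of_pencil_map {F : Type*} [Field F] [CharZero F] {θ : F} (hθ : θ ^ 2 = -3)
    (hc : ∀ x : F, x ^ 3 ≠ 10) {d d' : ℤ} (hd : d ≠ 0)
    (G : (Fin 5 → F) →ₗ[F] (Fin 5 → F)) (hG : Function.Bijective G) {α β : F} (hα : α ≠ 0)
    (h : ∀ x, Q0 d' x + θ * Qinf d' x = α * Q0 d (G x) + β * Qinf d (G x)) :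
    IsSquare ((d : F) * d') := by
  have h' : ∀ x, Q0 d' x + θ * Qinf d' x = α * (Q0 d (G x) + β / α * Qinf d (G x)) := fun x => by
    rw [h]
    field_simp
  have hμ : (β / α) ^ 2 = -3 := by
    refine sq_eq_neg_three_of_singular hd hc (w := G ![θ, 1, 0, 0, 0]) (fun h0 => ?_) fun y => ?_
    · rw [map_eq_zero_iff G hG.1] at h0
      simpa using congrFun h0 1
    · obtain ⟨x, rfl⟩ := hG.2 y
      refine mul_left_cancel₀ hα ?_
      rw [← map_add, ← h', ← h']
      simp only [Q0, Qinf, Pi.add_apply, Matrix.cons_val]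
      linear_combination (-(d' : F) * (1 + 2 * x 1)) * hθ
  generalize β / α = μ at h' hμ
  let S : Matrix (Fin 5) (Fin 4) F :=
    !![1, 0, 0, 0; 0, 0, 0, 0; 0, 1, 0, 0; 0, 0, 1, 0; 0, 0, 0, 1]
  have hS : coneProjection θ * S = 1 := by
    ext i j
    fin_cases i <;> fin_cases j <;>
      simp [S, coneProjection, Matrix.mul_apply, Fin.sum_univ_succ]
  have key := (isSymm_coneGram d' θ).det_eq_of_forall_dotProduct (isSymm_coneGram d μ) (c := α)
    (M := coneProjection μ * LinearMap.toMatrix' G * S) fun x => by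
      have hx := h' (S *ᵥ x)
      rw [pencil_eq_dotProduct d' hθ, pencil_eq_dotProduct d hμ, Matrix.mulVec_mulVec, hS,
        Matrix.one_mulVec] at hx
      rw [hx, ← LinearMap.toMatrix'_mulVec G, Matrix.mulVec_mulVec, Matrix.mulVec_mulVec,
        Matrix.mul_assoc]
  rw [det_coneGram d' hθ, det_coneGram d hμ, Fintype.card_fin] at key
  refine ⟨α ^ 2 * (coneProjection μ * LinearMap.toMatrix' G * S).det * d, ?_⟩
  linear_combination (-(d : F) / 108) * key

end

theorem Squarefree.eq_of_isSquare_mul {a b : ℤ} (ha : Squarefree a) (hb : Squarefree b)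
    (h : IsSquare (a * b)) : a = b := by
  obtain ⟨s, hs⟩ := h
  obtain ⟨m, rfl⟩ : a ∣ s := (ha.dvd_pow_iff_dvd two_ne_zero).1 ⟨b, by rw [hs]; ring⟩
  have hbm : b = a * (m * m) := mul_left_cancel₀ ha.ne_zero (by rw [hs]; ring)
  have hm : IsUnit m := hb m ⟨a, by rw [hbm]; ring⟩
  rw [hbm, Int.isUnit_mul_self hm, mul_one]

theorem sq_ne_neg_three (x : ℚ) : x ^ 2 ≠ -3 + 0 * x := by
  nlinarith [sq_nonneg x]

instance : Fact (∀ x : ℚ, x ^ 2 ≠ -3 + 0 * x) := ⟨sq_ne_neg_three⟩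

/-- The field `ℚ(√-3)`. -/
abbrev EisensteinField : Type := QuadraticAlgebra ℚ (-3) 0

theorem EisensteinField.cube_ne_ten (x : EisensteinField) : x ^ 3 ≠ 10 := by
  intro h
  have h1 := congrArg QuadraticAlgebra.norm h
  rw [map_pow] at h1
  refine rat_cube_ne_hundred _ (h1.trans ?_)
  rw [QuadraticAlgebra.norm_def]
  norm_num [QuadraticAlgebra.re_ofNat, QuadraticAlgebra.im_ofNat]

theorem EisensteinField.eq_of_isSquare_mul {a b : ℤ} (ha : Squarefree a) (hb : Squarefree b)
    (ha3 : ¬ 3 ∣ a) (hb3 : ¬ 3 ∣ b) (h : IsSquare ((a : EisensteinField) * b)) : a = b := by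
  obtain ⟨⟨p, q⟩, hy⟩ := h
  have hre := congrArg QuadraticAlgebra.re hy
  have him := congrArg QuadraticAlgebra.im hy
  simp only [QuadraticAlgebra.re_mul, QuadraticAlgebra.im_mul, QuadraticAlgebra.re_intCast,
    QuadraticAlgebra.im_intCast] at hre him
  have hpq : p * q = 0 := by linear_combination -him / 2
  rcases mul_eq_zero.1 hpq with rfl | rfl
  · exfalso
    have hsq : IsSquare (((-3 * (a * b) : ℤ)) : ℚ) := ⟨3 * q, by
      push_cast
      linear_combination -3 * hre⟩
    obtain ⟨s, hs⟩ := Rat.isSquare_intCast_iff.1 hsq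
    have h3 : (3 : ℤ) ∣ s := Int.prime_three.dvd_of_dvd_pow (n := 2) ⟨-(a * b), by linarith⟩
    obtain ⟨m, rfl⟩ := h3
    have : (3 : ℤ) ∣ a * b := ⟨-m ^ 2, by linarith⟩
    exact (Int.prime_three.dvd_or_dvd this).elim ha3 hb3
  · refine ha.eq_of_isSquare_mul hb (Rat.isSquare_intCast_iff.1 ⟨p, ?_⟩)
    push_cast
    linear_combination hre

/-- Extension of scalars of a linear endomorphism from `ℚ` to `ℚ(√-3)`. -/
def EisensteinField.extend (g : (Fin 5 → ℚ) →ₗ[ℚ] (Fin 5 → ℚ)) :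
    (Fin 5 → EisensteinField) →ₗ[EisensteinField] (Fin 5 → EisensteinField) where
  toFun x i := ⟨g (fun j => (x j).re) i, g (fun j => (x j).im) i⟩
  map_add' x y := by
    have h (u v : Fin 5 → ℚ) (i) : g (fun j => u j + v j) i = g u i + g v i := by
      rw [← Pi.add_apply, ← map_add]
      rfl
    ext i <;> simp [h]
  map_smul' c x := by
    have h (p q : ℚ) (u v : Fin 5 → ℚ) (i) :
        g (fun j => p * u j + q * v j) i = p * g u i + q * g v i := by
      have := congrFun (map_add g (p • u) (q • v)) i
      rwa [map_smul, map_smul] at this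
    ext i
    · have := h c.re (-3 * c.im) (fun j => (x j).re) (fun j => (x j).im) i
      simpa [mul_assoc] using this
    · have := h c.re c.im (fun j => (x j).im) (fun j => (x j).re) i
      simpa [mul_assoc] using this

theorem EisensteinField.bijective_extend (g : (Fin 5 → ℚ) ≃ₗ[ℚ] (Fin 5 → ℚ)) :
    Function.Bijective (EisensteinField.extend g.toLinearMap) := by
  refine Function.bijective_iff_has_inverse.2
    ⟨EisensteinField.extend g.symm.toLinearMap, fun x => ?_, fun x => ?_⟩ <;>
  · ext i <;> simp [EisensteinField.extend]

theorem EisensteinField.Q0_eq (d : ℤ) (x : Fin 5 → EisensteinField) :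
    Q0 d x = ⟨Q0 d (fun j => (x j).re) - 3 * Q0 d (fun j => (x j).im),
      Q0 d ((fun j => (x j).re) + fun j => (x j).im) - Q0 d (fun j => (x j).re) -
        Q0 d (fun j => (x j).im)⟩ := by
  ext <;> simp [Q0, pow_two, QuadraticAlgebra.re_ofNat, QuadraticAlgebra.im_ofNat] <;> ring

theorem EisensteinField.Qinf_eq (d : ℤ) (x : Fin 5 → EisensteinField) :
    Qinf d x = ⟨Qinf d (fun j => (x j).re) - 3 * Qinf d (fun j => (x j).im),
      Qinf d ((fun j => (x j).re) + fun j => (x j).im) - Qinf d (fun j => (x j).re) -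
        Qinf d (fun j => (x j).im)⟩ := by
  ext <;> simp [Qinf, pow_two, QuadraticAlgebra.re_ofNat, QuadraticAlgebra.im_ofNat] <;> ring

theorem EisensteinField.pencil_extend {d d' : ℤ} (g : (Fin 5 → ℚ) →ₗ[ℚ] (Fin 5 → ℚ))
    {a b c e : ℚ} (h0 : ∀ x, Q0 d' x = a * Q0 d (g x) + b * Qinf d (g x))
    (hinf : ∀ x, Qinf d' x = c * Q0 d (g x) + e * Qinf d (g x)) (x : Fin 5 → EisensteinField) :
    Q0 d' x + ⟨0, 1⟩ * Qinf d' x = (⟨a, c⟩ : EisensteinField) * Q0 d (EisensteinField.extend g x) +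
      ⟨b, e⟩ * Qinf d (EisensteinField.extend g x) := by
  have e1 : (fun j => (EisensteinField.extend g x j).re) = g (fun j => (x j).re) := rfl
  have e2 : (fun j => (EisensteinField.extend g x j).im) = g (fun j => (x j).im) := rfl
  rw [Q0_eq, Qinf_eq, Q0_eq, Qinf_eq, e1, e2, ← map_add, h0, h0, h0, hinf, hinf, hinf]
  ext <;> simp <;> ring

theorem eq_of_pencil_equiv {d d' : ℤ} (hd : Squarefree d) (hd' : Squarefree d') (hd3 : ¬ 3 ∣ d)
    (hd3' : ¬ 3 ∣ d') (g : (Fin 5 → ℚ) ≃ₗ[ℚ] (Fin 5 → ℚ)) {a b c e : ℚ}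
    (h0 : ∀ x, Q0 d' x = a * Q0 d (g x) + b * Qinf d (g x))
    (hinf : ∀ x, Qinf d' x = c * Q0 d (g x) + e * Qinf d (g x)) : d = d' := by
  refine EisensteinField.eq_of_isSquare_mul hd hd' hd3 hd3' <|
    isSquare_mul_of_pencil_map (θ := ⟨0, 1⟩) ?_ EisensteinField.cube_ne_ten hd.ne_zero
      (EisensteinField.extend g.toLinearMap) (EisensteinField.bijective_extend g) ?_
      (EisensteinField.pencil_extend g.toLinearMap h0 hinf)
  · ext <;> simp [pow_two, QuadraticAlgebra.re_ofNat, QuadraticAlgebra.im_ofNat]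
  · intro hα
    obtain rfl : a = 0 := congrArg QuadraticAlgebra.re hα
    obtain rfl : c = 0 := congrArg QuadraticAlgebra.im hα
    have h1 : ∀ x, e * Q0 d' x = b * Qinf d' x := fun x => by
      rw [h0, hinf]
      ring
    have h2 := h1 ![0, 0, 1, 0, 0]
    have h3 := h1 ![0, 0, 0, 0, 1]
    have h4 := h0 ![0, 0, 1, 0, 0]
    simp only [Q0, Qinf, Matrix.cons_val] at h2 h3
    have hb : b = 0 := by linear_combination h3
    rw [hb] at h4
    simp only [Q0, Matrix.cons_val] at h4
    norm_num at h4

theorem eq_of_span_eq {d d' : ℤ} (hd : Squarefree d) (hd' : Squarefree d') (hd3 : ¬ 3 ∣ d)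
    (hd3' : ¬ 3 ∣ d') (g : (Fin 5 → ℚ) ≃ₗ[ℚ] (Fin 5 → ℚ))
    (h : Submodule.span ℚ
        {(fun x => Q0 d (g x) : (Fin 5 → ℚ) → ℚ), (fun x => Qinf d (g x))} =
      Submodule.span ℚ
        {(fun x => Q0 d' x : (Fin 5 → ℚ) → ℚ), (fun x => Qinf d' x)}) : d = d' := by
  have h0 : (fun x => Q0 d' x : (Fin 5 → ℚ) → ℚ) ∈ Submodule.span ℚ
      {(fun x => Q0 d (g x) : (Fin 5 → ℚ) → ℚ), (fun x => Qinf d (g x))} :=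
    h ▸ Submodule.subset_span (by simp)
  have hinf : (fun x => Qinf d' x : (Fin 5 → ℚ) → ℚ) ∈ Submodule.span ℚ
      {(fun x => Q0 d (g x) : (Fin 5 → ℚ) → ℚ), (fun x => Qinf d (g x))} :=
    h ▸ Submodule.subset_span (by simp)
  obtain ⟨a, b, hab⟩ := Submodule.mem_span_pair.1 h0
  obtain ⟨c, e, hce⟩ := Submodule.mem_span_pair.1 hinf
  exact eq_of_pencil_equiv hd hd' hd3 hd3' g (fun x => (congrFun hab x).symm)
    fun x => (congrFun hce x).symm

/-- There are infinitely many squarefree integers `d` for which the quartic del Pezzo surface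
`X_d = V(Q₀⁽ᵈ⁾) ∩ V(Q∞⁽ᵈ⁾)` has (i) no closed points of degree dividing 2 (no nonzero common
zero over any field of `ℚ`-dimension at most 2), and (ii) index 2 (the gcd of degrees of its
closed points is 2); moreover the surfaces `X_d` for these `d` are pairwise non-isomorphic
(no linear change of coordinates carries one pencil of quadrics onto another). -/
theorem stmt9 :
    ∃ S : Set ℤ, S.Infinite ∧
      (∀ d ∈ S, Squarefree d ∧
        (∀ (K : Type) [Field K] [Algebra ℚ K] [FiniteDimensional ℚ K],
          Module.finrank ℚ K ≤ 2 →
            ∀ x : Fin 5 → K, Q0 d x = 0 → Qinf d x = 0 → x = 0) ∧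
        (∀ n ∈ Degrees d, 2 ∣ n) ∧
        (∀ m : ℕ, (∀ n ∈ Degrees d, m ∣ n) → m ∣ 2)) ∧
      ∀ d ∈ S, ∀ d' ∈ S, d ≠ d' →
        ¬ ∃ g : (Fin 5 → ℚ) ≃ₗ[ℚ] (Fin 5 → ℚ),
            Submodule.span ℚ
                {(fun x => Q0 d (g x) : (Fin 5 → ℚ) → ℚ), (fun x => Qinf d (g x))} =
              Submodule.span ℚ
                {(fun x => Q0 d' x : (Fin 5 → ℚ) → ℚ), (fun x => Qinf d' x)} := by
  refine ⟨parameterSet, infinite_parameterSet, fun d hd => ?_, fun d hd d' hd' hne => ?_⟩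
  · have hmem := hd
    obtain ⟨hsq, h12, h5, r, k, hk⟩ := hd
    have h3 : ¬ 3 ∣ d := by omega
    refine ⟨hsq, fun K _ _ _ hK x h0 hinf => ?_, fun n hn => two_dvd_of_mem_degrees h3 hn,
      fun m hm => dvd_two_of_forall_degrees hsq.ne_zero hk hm⟩
    exact eq_zero_of_finrank_le_two h3 (fun s r hsr => not_vanishesOnPlane_pencilForm hsq h12 h5
      (fun q _ hqd => exists_root_mod_of_mem_parameterSet hmem q hqd) hsr) K hK x h0 hinf
  · rintro ⟨g, hg⟩
    obtain ⟨hsq, h12, -⟩ := hd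
    obtain ⟨hsq', h12', -⟩ := hd'
    exact hne (eq_of_span_eq hsq hsq' (by omega) (by omega) g hg)
end

section
/- Let k be a field of characteristic different from 2, let K/k be a field extension of degree 2, and let Q_0, Q_∞ be quadratic forms on k^n (extended to K^n by base change). Suppose there exists a nonzero vector x ∈ K^n with Q_0(x) = 0 and Q_∞(x) = 0. Then either there exists a nonzero vector y ∈ k^n with Q_0(y) = Q_∞(y) = 0, or there exist a 2-dimensional k-linear subspace W of k^n and a pair (a,b) ∈ k × k with (a,b) ≠ (0,0) such that the quadratic form b·Q_0 + a·Q_∞ vanishes identically on W. (That is, a degree 2 point on the intersection of two quadrics yields either a rational point or a rational line on some quadric of the pencil.) -/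
open MvPolynomial in
/-- The value of a linear form on a combination of two rational vectors. -/
lemma MvPolynomial.exists_aeval_combination_of_isHomogeneous_one {σ k K : Type*} [CommRing k]
    [CommRing K] [Algebra k K] {L : MvPolynomial σ k} (hL : L.IsHomogeneous 1) (u v : σ → k) :
    ∃ p q : k, ∀ α β : K,
      aeval (fun i => α * algebraMap k K (u i) + β * algebraMap k K (v i)) L =
        algebraMap k K p * α + algebraMap k K q * β := by
  have hmem : L ∈ Submodule.span k (Set.range (X : σ → MvPolynomial σ k)) := by
    rw [← homogeneousSubmodule_one_eq_span_X]
    exact hL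
  clear hL
  induction hmem using Submodule.span_induction with
  | mem L h =>
    obtain ⟨i, rfl⟩ := h
    exact ⟨u i, v i, fun α β => by rw [aeval_X]; ring⟩
  | zero => exact ⟨0, 0, fun α β => by simp⟩
  | add L M _ _ hL hM =>
    obtain ⟨p, q, h⟩ := hL
    obtain ⟨p', q', h'⟩ := hM
    exact ⟨p + p', q + q', fun α β => by rw [map_add, h, h', map_add, map_add]; ring⟩
  | smul c L _ hL =>
    obtain ⟨p, q, h⟩ := hL
    exact ⟨c * p, c * q, fun α β => by
      rw [map_smul, h, Algebra.smul_def, map_mul, map_mul]; ring⟩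

open MvPolynomial in
/-- The restriction of a quadratic form to the span of two rational vectors. -/
lemma MvPolynomial.exists_aeval_combination_of_isHomogeneous_two {σ k K : Type*} [CommRing k]
    [CommRing K] [Algebra k K] {Q : MvPolynomial σ k} (hQ : Q.IsHomogeneous 2) (u v : σ → k) :
    ∃ p q r : k, ∀ α β : K,
      aeval (fun i => α * algebraMap k K (u i) + β * algebraMap k K (v i)) Q =
        algebraMap k K p * α ^ 2 + algebraMap k K q * (α * β) + algebraMap k K r * β ^ 2 := by
  have hmem : Q ∈ homogeneousSubmodule σ k 1 * homogeneousSubmodule σ k 1 := by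
    rw [← pow_two, homogeneousSubmodule_one_pow]
    exact hQ
  clear hQ
  induction hmem using Submodule.mul_induction_on' with
  | mem_mul_mem L hL M hM =>
    obtain ⟨p, q, h⟩ := exists_aeval_combination_of_isHomogeneous_one (K := K) hL u v
    obtain ⟨p', q', h'⟩ := exists_aeval_combination_of_isHomogeneous_one (K := K) hM u v
    exact ⟨p * p', p * q' + q * p', q * q', fun α β => by
      simp only [map_mul, map_add, h, h']; ring⟩
  | add P _ R _ hP hR =>
    obtain ⟨p, q, r, h⟩ := hP
    obtain ⟨p', q', r', h'⟩ := hR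
    exact ⟨p + p', q + q', r + r', fun α β => by simp only [map_add, h, h']; ring⟩

open MvPolynomial in
/-- If `s` is a root of `X ^ 2 - c * X - d` and `u + s * v` is a zero of a quadratic form over `k`,
then on the span of `u` and `v` the form is proportional to the norm form of `k[s]`. -/
lemma MvPolynomial.exists_eval_combination_eq_mul {σ k K : Type*} [Field k] [Field K] [Algebra k K]
    {s : K} (hs : ∀ a b : k, algebraMap k K a + algebraMap k K b * s = 0 → a = 0 ∧ b = 0)
    {c d : k} (hcd : s ^ 2 = algebraMap k K d + algebraMap k K c * s)
    {Q : MvPolynomial σ k} (hQ : Q.IsHomogeneous 2) (u v : σ → k)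
    (h0 : aeval (fun i => algebraMap k K (u i) + s * algebraMap k K (v i)) Q = 0) :
    ∃ r : k, ∀ α β : k,
      eval (fun i => α * u i + β * v i) Q = r * (β ^ 2 - c * (α * β) - d * α ^ 2) := by
  obtain ⟨p, q, r, h⟩ := exists_aeval_combination_of_isHomogeneous_two (K := K) hQ u v
  have h1 := h 1 s
  simp only [one_mul, h0] at h1
  obtain ⟨hp, hq⟩ := hs (p + r * d) (q + r * c) (by
    simp only [map_add, map_mul]
    linear_combination -h1 - algebraMap k K r * hcd)
  refine ⟨r, fun α β => (algebraMap k K).injective ?_⟩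
  have h2 := h (algebraMap k K α) (algebraMap k K β)
  simp only [← map_mul, ← map_add, ← map_pow] at h2
  rw [← coe_aeval_eq_eval, RingHom.coe_coe, ← aeval_algebraMap_apply]
  refine h2.trans (congrArg _ ?_)
  linear_combination α ^ 2 * hp + α * β * hq

open MvPolynomial in
/-- A rational vector with a nonzero multiple that is a zero of a quadratic form is itself a
zero. -/
lemma MvPolynomial.eval_eq_zero_of_aeval_smul_eq_zero {σ k K : Type*} [Field k]
    [Field K] [Algebra k K] {Q : MvPolynomial σ k} (hQ : Q.IsHomogeneous 2) {l : K}
    (hl : l ≠ 0) {w : σ → k} (h : aeval (l • fun i => algebraMap k K (w i)) Q = 0) :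
    eval w Q = 0 := by
  obtain ⟨p, q, r, hp⟩ := exists_aeval_combination_of_isHomogeneous_two (K := K) hQ w 0
  have hl' : aeval (fun i => l * algebraMap k K (w i)) Q = algebraMap k K p * l ^ 2 := by
    simpa using hp l 0
  have h1 : aeval (algebraMap k K ∘ w) Q = algebraMap k K p := by
    simpa [Function.comp_def] using hp 1 0
  have hp0 : algebraMap k K p = 0 :=
    (mul_eq_zero.1 (hl'.symm.trans h)).resolve_right (pow_ne_zero 2 hl)
  rw [hp0, aeval_algebraMap_eq_zero_iff] at h1
  rwa [← coe_aeval_eq_eval, RingHom.coe_coe]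

/-- Let `k` be a field of characteristic `≠ 2`, `K/k` a degree-2 field extension, and
`Q₀, Q∞` quadratic forms on `kⁿ` (homogeneous degree-2 polynomials, extended to `Kⁿ` by base
change). If `Q₀` and `Q∞` have a common nonzero zero in `Kⁿ` (a degree-2 point of the
intersection), then either they have a common nonzero zero in `kⁿ` (a rational point), or some
nontrivial form `b·Q₀ + a·Q∞` of the pencil vanishes identically on some 2-dimensional
`k`-linear subspace of `kⁿ` (a rational line on a quadric of the pencil). -/
theorem stmt10 (k : Type*) [Field k] (hchar : ringChar k ≠ 2) (n : ℕ)
    (K : Type*) [Field K] [Algebra k K] (hK : Module.finrank k K = 2)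
    (Q0 Qinf : MvPolynomial (Fin n) k)
    (hQ0 : Q0.IsHomogeneous 2) (hQinf : Qinf.IsHomogeneous 2)
    (x : Fin n → K) (hx : x ≠ 0)
    (hx0 : MvPolynomial.aeval x Q0 = 0) (hxinf : MvPolynomial.aeval x Qinf = 0) :
    (∃ y : Fin n → k, y ≠ 0 ∧ MvPolynomial.eval y Q0 = 0 ∧ MvPolynomial.eval y Qinf = 0) ∨
    (∃ (W : Submodule k (Fin n → k)) (a b : k), Module.finrank k W = 2 ∧
      (a, b) ≠ (0, 0) ∧
      ∀ w ∈ W, b * MvPolynomial.eval w Q0 + a * MvPolynomial.eval w Qinf = 0) := by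
  have : Module.Finite k K := Module.finite_of_finrank_eq_succ hK
  obtain ⟨s, hs⟩ : ∃ s : K, ∀ a : k, a • (1 : K) ≠ s := by
    by_contra! hcon
    have := finrank_le_one (1 : K) hcon
    omega
  have hli : LinearIndependent k ![(1 : K), s] :=
    (LinearIndependent.pair_iff' one_ne_zero).2 hs
  have hspan := hli.span_eq_top_of_card_eq_finrank (by simp [hK])
  have hrep (z : K) : ∃ a b : k, z = algebraMap k K a + s * algebraMap k K b := by
    have hz : z ∈ Submodule.span k (Set.range ![(1 : K), s]) := hspan ▸ Submodule.mem_top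
    rw [Matrix.range_cons_cons_empty, Submodule.mem_span_pair] at hz
    obtain ⟨a, b, rfl⟩ := hz
    exact ⟨a, b, by simp only [Algebra.smul_def]; ring⟩
  have hs' (a b : k) (h : algebraMap k K a + algebraMap k K b * s = 0) : a = 0 ∧ b = 0 := by
    refine LinearIndependent.pair_iff.1 hli a b ?_
    simpa only [Algebra.smul_def, mul_one] using h
  obtain ⟨d, c, hdc⟩ := hrep (s ^ 2)
  rw [mul_comm s] at hdc
  choose u v huv using fun i => hrep (x i)
  obtain rfl : x = fun i => algebraMap k K (u i) + s * algebraMap k K (v i) := funext huv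
  by_cases huv' : LinearIndependent k ![u, v]
  · right
    obtain ⟨r, hr⟩ := MvPolynomial.exists_eval_combination_eq_mul hs' hdc hQ0 u v hx0
    obtain ⟨r', hr'⟩ := MvPolynomial.exists_eval_combination_eq_mul hs' hdc hQinf u v hxinf
    obtain ⟨a, b, hab, h⟩ : ∃ a b : k, (a, b) ≠ (0, 0) ∧ b * r + a * r' = 0 := by
      by_cases h : r = 0
      · exact ⟨0, 1, by simp, by simp [h]⟩
      · exact ⟨-r, r', by simp [h], by ring⟩
    refine ⟨Submodule.span k (Set.range ![u, v]), a, b, ?_, hab, fun w hw => ?_⟩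
    · rw [finrank_span_eq_card huv', Fintype.card_fin]
    · rw [Matrix.range_cons_cons_empty, Submodule.mem_span_pair] at hw
      obtain ⟨α, β, rfl⟩ := hw
      have e : α • u + β • v = fun i => α * u i + β * v i := rfl
      rw [e, hr, hr']
      linear_combination (β ^ 2 - c * (α * β) - d * α ^ 2) * h
  · left
    obtain ⟨w, l, hw⟩ : ∃ (w : Fin n → k) (l : K),
        (fun i => algebraMap k K (u i) + s * algebraMap k K (v i)) =
          l • fun i => algebraMap k K (w i) := by
      by_cases hv : v = 0
      · exact ⟨u, 1, by ext i; simp [hv]⟩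
      · rw [LinearIndependent.pair_symm_iff, LinearIndependent.pair_iff' hv] at huv'
        push Not at huv'
        obtain ⟨a, rfl⟩ := huv'
        refine ⟨v, algebraMap k K a + s, ?_⟩
        ext i
        simp only [Pi.smul_apply, smul_eq_mul, map_mul]
        ring
    rw [hw] at hx hx0 hxinf
    have hl : l ≠ 0 := left_ne_zero_of_smul hx
    refine ⟨w, ?_, MvPolynomial.eval_eq_zero_of_aeval_smul_eq_zero hQ0 hl hx0,
      MvPolynomial.eval_eq_zero_of_aeval_smul_eq_zero hQinf hl hxinf⟩
    rintro rfl
    exact hx (by ext i; simp)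
end

section
/- Let d be an integer not divisible by 3, and set Q_0 = d(u_0^2 - 3u_1^2) + 6u_2^2 + 6u_2u_3 - 6u_3u_4 and Q_∞ = -2d*u_0u_1 + u_2^2 - 2u_2u_4 - 3u_3^2 - u_4^2. Then there is no nonzero vector x ∈ ℚ_3^5 with Q_0(x) = 0 and Q_∞(x) = 0. (That is, X_d(ℚ_3) = ∅.) -/
instance : Fact (Nat.Prime 3) := ⟨by norm_num⟩

/-- Two `3`-adic integers are both divisible by `3` as soon as the sum of their squares is:
`-1` is not a square modulo `3`. -/
lemma PadicInt.three_dvd_of_dvd_sq_add_sq {s t : ℤ_[3]} (h : (3 : ℤ_[3]) ∣ s ^ 2 + t ^ 2) :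
    (3 : ℤ_[3]) ∣ s ∧ (3 : ℤ_[3]) ∣ t := by
  have key (z : ℤ_[3]) : (3 : ℤ_[3]) ∣ z ↔ PadicInt.toZMod z = 0 := by
    rw [← RingHom.mem_ker, PadicInt.ker_toZMod, PadicInt.maximalIdeal_eq_span_p,
      Ideal.mem_span_singleton, Nat.cast_ofNat]
  rw [key, map_add, map_pow, map_pow] at h
  rw [key, key]
  have aux : ∀ v w : ZMod 3, v ^ 2 + w ^ 2 = 0 → v = 0 ∧ w = 0 := by decide
  exact aux _ _ h

/-- If `d` is prime to `3`, every common zero of the two forms over `ℤ₃` is divisible by `3`. -/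
lemma three_dvd_of_forms_eq_zero {d a b c e f : ℤ_[3]} (hd : ¬ (3 : ℤ_[3]) ∣ d)
    (h₀ : d * (a ^ 2 - 3 * b ^ 2) + 6 * c ^ 2 + 6 * c * e - 6 * e * f = 0)
    (h₁ : -2 * d * a * b + c ^ 2 - 2 * c * f - 3 * e ^ 2 - f ^ 2 = 0) :
    (3 : ℤ_[3]) ∣ a ∧ (3 : ℤ_[3]) ∣ b ∧ (3 : ℤ_[3]) ∣ c ∧ (3 : ℤ_[3]) ∣ e ∧ (3 : ℤ_[3]) ∣ f := by
  have hp : Prime (3 : ℤ_[3]) := by simpa using PadicInt.prime_p (p := 3)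
  have descend {z : ℤ_[3]} (h : (3 : ℤ_[3]) ∣ d * z ^ 2) : (3 : ℤ_[3]) ∣ z :=
    hp.dvd_of_dvd_pow ((hp.dvd_or_dvd h).resolve_left hd)
  obtain ⟨A, rfl⟩ : (3 : ℤ_[3]) ∣ a :=
    descend ⟨d * b ^ 2 - 2 * c ^ 2 - 2 * c * e + 2 * e * f, by linear_combination h₀⟩
  obtain ⟨hcf, F, rfl⟩ := PadicInt.three_dvd_of_dvd_sq_add_sq (s := c - f) (t := f)
    ⟨2 * d * A * b + e ^ 2 + f ^ 2, by linear_combination h₁⟩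
  obtain ⟨C, rfl⟩ : (3 : ℤ_[3]) ∣ c := (dvd_sub_left (dvd_mul_right 3 F)).1 hcf
  obtain ⟨B, rfl⟩ : (3 : ℤ_[3]) ∣ b :=
    descend ⟨d * A ^ 2 + 6 * C ^ 2 + 2 * C * e - 2 * e * F, mul_left_cancel₀ hp.ne_zero (by
      linear_combination -h₀)⟩
  have he : (3 : ℤ_[3]) ∣ e := hp.dvd_of_dvd_pow (n := 2)
    ⟨-2 * d * A * B + C ^ 2 - 2 * C * F - F ^ 2, mul_left_cancel₀ hp.ne_zero (by
      linear_combination -h₁)⟩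
  exact ⟨dvd_mul_right .., dvd_mul_right .., dvd_mul_right .., he, dvd_mul_right ..⟩

/-- If `3 ∤ d`, the surface `X_d = V(Q₀) ∩ V(Q∞)` has no `ℚ₃`-points: the forms `Q₀`, `Q∞`
have no common nonzero zero in `ℚ₃⁵`. -/
theorem stmt11 (d : ℤ) (hd : ¬ (3 ∣ d)) :
    ∀ x : Fin 5 → ℚ_[3], Q0 d x = 0 → Qinf d x = 0 → x = 0 := by
  intro x h₀ h₁
  obtain ⟨i, -, hi⟩ := Finset.exists_max_image Finset.univ (fun j => ‖x j‖) Finset.univ_nonempty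
  by_contra hx
  have hxi : x i ≠ 0 := fun h => hx <| funext fun j => by simpa [h] using hi j (Finset.mem_univ j)
  have hle (j : Fin 5) : ‖x j / x i‖ ≤ 1 := by
    rw [norm_div]
    exact div_le_one_of_le₀ (hi j (Finset.mem_univ j)) (norm_nonneg _)
  let y (j : Fin 5) : ℤ_[3] := ⟨x j / x i, hle j⟩
  have hy (j : Fin 5) : (y j : ℚ_[3]) = x j / x i := rfl
  have hnum (n : ℕ) [n.AtLeastTwo] : ((ofNat(n) : ℤ_[3]) : ℚ_[3]) = ofNat(n) :=
    PadicInt.coe_natCast n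
  have hd' : ¬ (3 : ℤ_[3]) ∣ (d : ℤ_[3]) := by
    intro h
    have h' := (PadicInt.norm_lt_one_iff_dvd (d : ℤ_[3])).2 (by simpa using h)
    exact hd (by exact_mod_cast PadicInt.norm_int_lt_one_iff_dvd d |>.1 h')
  have hdvd := three_dvd_of_forms_eq_zero (a := y 0) (b := y 1) (c := y 2) (e := y 3) (f := y 4) hd'
    (by
      apply Subtype.coe_injective
      push_cast [hy, hnum]
      rw [Q0] at h₀
      field_simp
      linear_combination h₀)
    (by
      apply Subtype.coe_injective
      push_cast [hy, hnum]
      rw [Qinf] at h₁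
      field_simp
      linear_combination h₁)
  have hyi : y i = 1 := Subtype.coe_injective (div_self hxi)
  have h3 : (3 : ℤ_[3]) ∣ y i := by
    obtain ⟨k0, k1, k2, k3, k4⟩ := hdvd
    fin_cases i <;> assumption
  have hp : Prime (3 : ℤ_[3]) := by simpa using PadicInt.prime_p (p := 3)
  exact hp.not_dvd_one (hyi ▸ h3)
end

section
/- The set of squarefree integers d satisfying both of the following conditions is infinite: (i) d ≡ 5 (mod 12); and (ii) for every prime p dividing d, every finite field extension L of ℚ_p, and every θ ∈ L satisfying θ^3 + 3θ^2 + 3θ - 9 = 0 and generating L over ℚ_p, the element θ is a square in L. -/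
/-- If `u` is a root of `X⁴ + 6X² - 24X - 3`, then the cubic with root `u` prescribed as the trace
of a square root has all its roots `θ` squares: `θ = ((uθ + 3) / (θ + v))²`, `v = (u² + 3) / 2`. -/
theorem exists_sq_eq_of_quartic_root {L : Type*} [Field L] [CharZero L] {u θ : L}
    (hu : u ^ 4 + 6 * u ^ 2 - 24 * u - 3 = 0) (hθ : θ ^ 3 + 3 * θ ^ 2 + 3 * θ - 9 = 0) :
    ∃ s : L, s ^ 2 = θ := by
  obtain ⟨v, hv⟩ : ∃ v : L, 2 * v = u ^ 2 + 3 := ⟨(u ^ 2 + 3) / 2, by field_simp⟩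
  have hv2 : v ^ 2 = 6 * u + 3 := by
    have : 4 * (v ^ 2 - (6 * u + 3)) = 0 := by linear_combination (2 * v + u ^ 2 + 3) * hv + hu
    have := (mul_eq_zero.mp this).resolve_left (by norm_num)
    linear_combination this
  have key : (u * θ + 3) ^ 2 = θ * (θ + v) ^ 2 := by
    linear_combination -hθ - θ ^ 2 * hv - θ * hv2
  have hne : θ + v ≠ 0 := by
    intro h0
    have h1 : u * θ + 3 = 0 := by simpa [h0] using key
    have h2 : u ^ 3 + 3 * u - 6 = 0 := by linear_combination 2 * u * h0 - 2 * h1 - u * hv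
    have h3 : u ^ 2 = 6 * u + 1 := by
      have : 3 * (u ^ 2 - 6 * u - 1) = 0 := by linear_combination hu - u * h2
      have := (mul_eq_zero.mp this).resolve_left (by norm_num)
      linear_combination this
    have h4 : 40 * u = 0 := by linear_combination h2 - (u + 6) * h3
    have h5 : u = 0 := (mul_eq_zero.mp h4).resolve_left (by norm_num)
    simp [h5] at h3
  refine ⟨(u * θ + 3) / (θ + v), ?_⟩
  rw [div_pow, key]
  field_simp

/-- Away from `30`, a root of `X⁴ + 6X² - 24X - 3` modulo `p` is simple. -/
theorem not_dvd_derivative_of_dvd_quartic {p : ℕ} (hp : p.Prime) (hp30 : ¬ (p : ℤ) ∣ 30) {n : ℤ}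
    (hn : (p : ℤ) ∣ n ^ 4 + 6 * n ^ 2 - 24 * n - 3) : ¬ (p : ℤ) ∣ 4 * n ^ 3 + 12 * n - 24 := by
  intro hd
  have h480 : (p : ℤ) ∣ 480 := by
    have e : (480 : ℤ) = (-4 * n ^ 2 - 16) * (n ^ 4 + 6 * n ^ 2 - 24 * n - 3) +
        (n ^ 3 + 7 * n - 18) * (4 * n ^ 3 + 12 * n - 24) := by ring
    rw [e]
    exact dvd_add (hn.mul_left _) (hd.mul_left _)
  have h30 : (p : ℤ) ∣ 30 ^ 5 := h480.trans (by norm_num)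
  exact hp30 ((Nat.prime_iff_prime_int.mp hp).dvd_of_dvd_pow h30)

theorem exists_padic_root_of_dvd_quartic {p : ℕ} [hp : Fact p.Prime] (hp30 : ¬ (p : ℤ) ∣ 30) {n : ℤ}
    (hn : (p : ℤ) ∣ n ^ 4 + 6 * n ^ 2 - 24 * n - 3) :
    ∃ u : ℚ_[p], u ^ 4 + 6 * u ^ 2 - 24 * u - 3 = 0 := by
  let F : Polynomial ℤ_[p] := .X ^ 4 + 6 * .X ^ 2 - 24 * .X - 3
  have hF (z : ℤ_[p]) : F.aeval z = z ^ 4 + 6 * z ^ 2 - 24 * z - 3 := by simp [F]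
  have hF' (z : ℤ_[p]) : F.derivative.aeval z = 4 * z ^ 3 + 12 * z - 24 := by
    simp [F, Polynomial.derivative_pow]
    ring
  have h1 : ‖F.aeval (n : ℤ_[p])‖ < 1 := by
    rw [hF]
    have := PadicInt.norm_int_lt_one_iff_dvd (p := p) (n ^ 4 + 6 * n ^ 2 - 24 * n - 3)
    push_cast at this
    exact this.mpr hn
  have h2 : ‖F.derivative.aeval (n : ℤ_[p])‖ = 1 := by
    rw [hF']
    have := PadicInt.norm_int_lt_one_iff_dvd (p := p) (4 * n ^ 3 + 12 * n - 24)
    push_cast at this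
    exact le_antisymm (PadicInt.norm_le_one _)
      (not_lt.mp fun h => not_dvd_derivative_of_dvd_quartic hp.out hp30 hn (this.mp h))
  obtain ⟨z, hz, -⟩ := hensels_lemma (F := F) (a := (n : ℤ_[p])) (by rw [h2]; simpa using h1)
  refine ⟨z, ?_⟩
  rw [hF] at hz
  exact_mod_cast congrArg ((↑) : ℤ_[p] → ℚ_[p]) hz

/-- A quarter of the value of `X⁴ + 6X² - 24X - 3` at `30m - 1`. -/
def quarterQuartic (m : ℤ) : ℤ := 202500 * m ^ 4 - 27000 * m ^ 3 + 2700 * m ^ 2 - 300 * m + 7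

theorem four_mul_quarterQuartic (m : ℤ) : 4 * quarterQuartic m =
    (30 * m - 1) ^ 4 + 6 * (30 * m - 1) ^ 2 - 24 * (30 * m - 1) - 3 := by
  unfold quarterQuartic
  ring

theorem quarterQuartic_pos (m : ℤ) : 0 < quarterQuartic m := by
  unfold quarterQuartic
  nlinarith [sq_nonneg (450 * m ^ 2 - 30 * m), Int.le_self_sq m, sq_nonneg m]

theorem quarterQuartic_modEq (m : ℤ) : quarterQuartic m ≡ 7 [ZMOD 12] := by
  refine (Int.modEq_iff_dvd.mpr ⟨16875 * m ^ 4 - 2250 * m ^ 3 + 225 * m ^ 2 - 25 * m, ?_⟩).symm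
  unfold quarterQuartic
  ring

theorem not_dvd_thirty_of_dvd_quarterQuartic {p : ℕ} (hp : p.Prime) {m : ℤ}
    (h : (p : ℤ) ∣ quarterQuartic m) : ¬ (p : ℤ) ∣ 30 := by
  intro h30
  have h7 : (p : ℤ) ∣ 7 := by
    have e : (7 : ℤ) = quarterQuartic m -
        30 * (6750 * m ^ 4 - 900 * m ^ 3 + 90 * m ^ 2 - 10 * m) := by
      unfold quarterQuartic
      ring
    rw [e]
    exact dvd_sub h (h30.mul_right _)
  have h1 : (p : ℤ) ∣ 1 := by
    have := dvd_sub (h7.mul_left 13) (h30.mul_left 3)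
    norm_num at this
    exact this
  exact hp.one_lt.ne' (by exact_mod_cast Int.eq_one_of_dvd_one (by positivity) h1)

theorem exists_large_prime_dvd_quarterQuartic (N : ℕ) :
    ∃ p : ℕ, p.Prime ∧ N < p ∧ ∃ m, (p : ℤ) ∣ quarterQuartic m := by
  obtain ⟨t, ht, w, hw⟩ : ∃ t : ℤ, t = (N.factorial : ℤ) ∧ ∃ w : ℤ,
      w = 202500 * 343 * t ^ 3 - 27000 * 49 * t ^ 2 + 2700 * 7 * t - 300 := ⟨_, rfl, _, rfl⟩
  have hE : quarterQuartic (7 * t) = 7 * (1 + t * w) := by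
    unfold quarterQuartic
    rw [hw]
    ring
  have ht1 : 1 ≤ t := by
    rw [ht]
    exact_mod_cast N.factorial_pos
  have hw0 : 0 < w := by
    rw [hw]
    nlinarith [pow_pos (show 0 < t by lia) 2, pow_pos (show 0 < t by lia) 3,
      mul_nonneg (sub_nonneg.mpr ht1) (sq_nonneg t)]
  have hne : (1 + t * w).natAbs ≠ 1 := by
    have : 0 < t * w := by positivity
    lia
  have hp := Nat.minFac_prime hne
  have hd : (((1 + t * w).natAbs.minFac : ℕ) : ℤ) ∣ 1 + t * w :=
    Int.natCast_dvd.mpr (Nat.minFac_dvd _)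
  refine ⟨_, hp, ?_, 7 * t, hE ▸ hd.mul_left 7⟩
  by_contra! hle
  have hdt : (((1 + t * w).natAbs.minFac : ℕ) : ℤ) ∣ t := by
    have := Int.natCast_dvd_natCast.mpr (hp.dvd_factorial.mpr hle)
    rwa [← ht] at this
  have h1 := (dvd_add_left (hdt.mul_right w)).mp hd
  exact hp.one_lt.ne' (by exact_mod_cast Int.eq_one_of_dvd_one (by positivity) h1)

theorem exists_large_prime_exactly_dvd_quarterQuartic (N : ℕ) :
    ∃ p : ℕ, p.Prime ∧ N < p ∧
      ∃ m, (p : ℤ) ∣ quarterQuartic m ∧ ¬ (p : ℤ) ^ 2 ∣ quarterQuartic m := by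
  obtain ⟨p, hp, hN, m, hm⟩ := exists_large_prime_dvd_quarterQuartic N
  have hp30 := not_dvd_thirty_of_dvd_quarterQuartic hp hm
  refine ⟨p, hp, hN, ?_⟩
  by_cases h2 : (p : ℤ) ^ 2 ∣ quarterQuartic m
  swap
  · exact ⟨m, hm, h2⟩
  obtain ⟨c, hc⟩ : ∃ c, 4 * quarterQuartic (m + p) = 4 * quarterQuartic m +
      p * (30 * (4 * (30 * m - 1) ^ 3 + 12 * (30 * m - 1) - 24)) + (p : ℤ) ^ 2 * c :=
    ⟨900 * (6 * (30 * m - 1) ^ 2 + 4 * (30 * m - 1) * (30 * p) + (30 * p) ^ 2 + 6), by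
      simp only [four_mul_quarterQuartic]; ring⟩
  refine ⟨m + p, ?_, fun h => ?_⟩
  · have e : ((m + p) - m) ∣ quarterQuartic (m + p) - quarterQuartic m := by
      refine ⟨202500 * ((m + p) ^ 3 + (m + p) ^ 2 * m + (m + p) * m ^ 2 + m ^ 3)
        - 27000 * ((m + p) ^ 2 + (m + p) * m + m ^ 2) + 2700 * ((m + p) + m) - 300, ?_⟩
      unfold quarterQuartic
      ring
    rw [add_sub_cancel_left] at e
    exact (dvd_sub_left hm).mp e
  · have h3 : (p : ℤ) ^ 2 ∣ p * (30 * (4 * (30 * m - 1) ^ 3 + 12 * (30 * m - 1) - 24)) := by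
      rw [show (p : ℤ) * (30 * (4 * (30 * m - 1) ^ 3 + 12 * (30 * m - 1) - 24)) =
        4 * quarterQuartic (m + p) - 4 * quarterQuartic m - (p : ℤ) ^ 2 * c by rw [hc]; ring]
      exact dvd_sub (dvd_sub (h.mul_left 4) (h2.mul_left 4)) (dvd_mul_right _ _)
    rw [sq] at h3
    have h4 := Int.dvd_of_mul_dvd_mul_left (by exact_mod_cast hp.ne_zero) h3
    refine ((Nat.prime_iff_prime_int.mp hp).dvd_or_dvd h4).elim hp30
      (not_dvd_derivative_of_dvd_quartic hp hp30 ?_)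
    rw [← four_mul_quarterQuartic]
    exact hm.mul_left 4


/-- There are infinitely many squarefree integers `d` with `d ≡ 5 (mod 12)` such that, for
every prime `p` dividing `d`, every root `θ` of `T³ + 3T² + 3T - 9` lying in a finite
extension `L/ℚ_p` that it generates is a square in `L` (i.e. a root `ζ` of the cubic is a
square in `ℚ_p ⊗ ℚ(ζ)`). -/
theorem stmt13 :
    {d : ℤ | Squarefree d ∧ d ≡ 5 [ZMOD 12] ∧
      ∀ (p : ℕ) [Fact p.Prime], (p : ℤ) ∣ d →
        ∀ (L : Type) [Field L] [Algebra ℚ_[p] L] [FiniteDimensional ℚ_[p] L],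
          ∀ θ : L, θ ^ 3 + 3 * θ ^ 2 + 3 * θ - 9 = 0 → Algebra.adjoin ℚ_[p] {θ} = ⊤ →
            ∃ s : L, s ^ 2 = θ}.Infinite := by
  intro hfin
  obtain ⟨N, hN⟩ := (hfin.image Int.natAbs).bddAbove
  obtain ⟨p, hp, hNp, m, hm, hm2⟩ := exists_large_prime_exactly_dvd_quarterQuartic N
  obtain ⟨a, b, ha, hb, hab, hsq⟩ := Nat.sq_mul_squarefree_of_pos
    (Int.natAbs_pos.mpr (quarterQuartic_pos m).ne')
  have hk : (b : ℤ) ^ 2 * a = quarterQuartic m := by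
    rw [← Int.natAbs_of_nonneg (quarterQuartic_pos m).le]
    exact_mod_cast hab
  have hpa : (p : ℤ) ∣ a := by
    rw [← hk] at hm hm2
    have hp' := Nat.prime_iff_prime_int.mp hp
    refine (hp'.dvd_or_dvd hm).resolve_left fun h => hm2 ?_
    exact (pow_dvd_pow_of_dvd (hp'.dvd_of_dvd_pow h) 2).mul_right _
  suffices hmem : Int.natAbs (-(a : ℤ)) ≤ N by
    have := Nat.le_of_dvd ha (by exact_mod_cast hpa)
    lia
  refine hN ⟨-(a : ℤ), ⟨?_, ?_, ?_⟩, rfl⟩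
  · exact fun x hx => Int.squarefree_natCast.mpr hsq x (dvd_neg.mp hx)
  · have h7 : (b : ℤ) ^ 2 * a ≡ 7 [ZMOD 12] := by
      rw [hk]
      exact quarterQuartic_modEq m
    have hz : ((b : ZMod 12)) ^ 2 * a = 7 := by
      exact_mod_cast (ZMod.intCast_eq_intCast_iff _ _ 12).mpr h7
    have dec : ∀ x y : ZMod 12, x ^ 2 * y = 7 → -y = 5 := by decide
    exact (ZMod.intCast_eq_intCast_iff _ _ 12).mp (by push_cast; exact dec _ _ hz)
  · intro q hq hqa L _ _ _ θ hθ _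
    have hqm : (q : ℤ) ∣ quarterQuartic m := hk ▸ ((dvd_neg.mp hqa).mul_left _)
    obtain ⟨u, hu⟩ := exists_padic_root_of_dvd_quartic
      (not_dvd_thirty_of_dvd_quarterQuartic hq.out hqm)
      (four_mul_quarterQuartic m ▸ hqm.mul_left 4)
    have : CharZero L := charZero_of_injective_algebraMap (algebraMap ℚ_[q] L).injective
    refine exists_sq_eq_of_quartic_root (u := algebraMap ℚ_[q] L u) ?_ hθ
    simpa only [map_sub, map_add, map_mul, map_pow, map_ofNat, map_zero] using
      congrArg (algebraMap ℚ_[q] L) hu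
end
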